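/- For all integers l ≥ 1, m ≥ 1 and all x < y in ℝ, lim_{n→∞} P( M̂_n^{(l)} ≤ u_n(x), M_n^{(m)} ≤ u_n(y) ) = ∑_{t=0}^{m−1} ∑_{i=0}^{m−t−1} ∑_{j=i}^{l−1} E ∫_{−∞}^{+∞} [ (λ g(y,z))^t / t! · exp(−λ g(y,z)) · ((1−λ) g(y,z))^i / i! · ((1−λ)(g(x,z) − g(y,z)))^{j−i} / (j−i)! · exp(−(1−λ) g(x,z)) ] dΦ(z). -/

import Mathlib

open MeasureTheory ProbabilityTheory Filter Real
open scoped Classical NNReal ENNReal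

/-- The normalizing levels `u_n(x) = x/a_n + b_n` with `a_n = (2 ln n)^{1/2}` and
`b_n = a_n - (ln ln n + ln (4π))/(2 a_n)`. -/
noncomputable def un (n : ℕ) (x : ℝ) : ℝ :=
  x / Real.sqrt (2 * Real.log n) +
    (Real.sqrt (2 * Real.log n) -
      (Real.log (Real.log n) + Real.log (4 * Real.pi)) / (2 * Real.sqrt (2 * Real.log n)))

/-- `g(x,z) = exp(-x - γ + √(2γ) z)`. -/
noncomputable def g (γ x z : ℝ) : ℝ := Real.exp (-x - γ + Real.sqrt (2 * γ) * z)

lemma gaussianPDFReal_std (x : ℝ) :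
    gaussianPDFReal 0 1 x = (√(2 * π))⁻¹ * rexp (-x ^ 2 / 2) := by
  simp [gaussianPDFReal]

lemma hasDerivAt_gaussianPDFReal_std (x : ℝ) :
    HasDerivAt (gaussianPDFReal 0 1) (-x * gaussianPDFReal 0 1 x) x := by
  have h : gaussianPDFReal 0 1 = fun x : ℝ => (√(2 * π))⁻¹ * rexp (-x ^ 2 / 2) :=
    funext gaussianPDFReal_std
  rw [h]
  have h1 : HasDerivAt (fun x : ℝ => -x ^ 2 / 2) (-x) x := by
    have := ((hasDerivAt_pow 2 x).fun_neg).div_const 2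
    refine this.congr_deriv ?_
    norm_num
    ring
  refine (h1.exp.const_mul ((√(2 * π))⁻¹)).congr_deriv ?_
  ring

/-- Stein's identity for the standard normal law. -/
lemma integral_id_mul_gaussianReal {q q' : ℝ → ℝ} {A B : ℝ}
    (hq : ∀ x, HasDerivAt q (q' x) x) (hA : ∀ x, |q x| ≤ A) (hB : ∀ x, |q' x| ≤ B)
    (hm : Measurable q') :
    ∫ x, x * q x ∂(gaussianReal 0 1) = ∫ x, q' x ∂(gaussianReal 0 1) := by
  have hqm : Measurable q :=
    (continuous_iff_continuousAt.2 fun x => (hq x).continuousAt).measurable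
  have i1 : Integrable (fun x => gaussianPDFReal 0 1 x * q' x) := by
    refine (integrable_gaussianPDFReal 0 1).mul_bdd (c := B) hm.aestronglyMeasurable ?_
    exact ae_of_all _ hB
  have i2 : Integrable (fun x => gaussianPDFReal 0 1 x * q x) := by
    refine (integrable_gaussianPDFReal 0 1).mul_bdd (c := A) hqm.aestronglyMeasurable ?_
    exact ae_of_all _ hA
  have hid : Integrable (fun x : ℝ => x * gaussianPDFReal 0 1 x) := by
    have h := integrable_mul_exp_neg_mul_sq (b := 1 / 2) (by norm_num)
    refine (h.const_mul ((√(2 * π))⁻¹)).congr (ae_of_all _ fun x => ?_)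
    simp only [gaussianPDFReal_std]
    rw [show -(1 / 2 : ℝ) * x ^ 2 = -x ^ 2 / 2 by ring]
    ring
  have i3 : Integrable (fun x => (-x * gaussianPDFReal 0 1 x) * q x) := by
    refine Integrable.mul_bdd (c := A) ?_ hqm.aestronglyMeasurable (ae_of_all _ hA)
    simpa [neg_mul] using hid.neg
  have := integral_mul_deriv_eq_deriv_mul_of_integrable
    (u := gaussianPDFReal 0 1) (v := q) (fun x _ => hasDerivAt_gaussianPDFReal_std x)
    (fun x _ => hq x) i1 i3 i2
  rw [integral_gaussianReal_eq_integral_smul one_ne_zero,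
    integral_gaussianReal_eq_integral_smul one_ne_zero]
  simp only [smul_eq_mul]
  rw [this, ← integral_neg]
  congr 1
  ext x
  ring

lemma abs_prod_le_one {ι : Type*} {s : Finset ι} {f : ι → ℝ} (h : ∀ i, |f i| ≤ 1) :
    |∏ i ∈ s, f i| ≤ 1 := by
  rw [Finset.abs_prod]
  exact Finset.prod_le_one (fun i _ => abs_nonneg _) (fun i _ => h i)

section IBP

variable {ι : Type*}

/-- Gaussian integration by parts against a product, conditionally on an independent vector. -/
lemma integral_mul_prod_of_indepFun {Ω : Type*} [MeasurableSpace Ω] {P : Measure Ω}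
    [IsProbabilityMeasure P] {G : Ω → ℝ} {W : Ω → ι → ℝ} (hG : Measurable G) (hW : Measurable W)
    (hlaw : P.map G = gaussianReal 0 1) (hind : IndepFun G W P) (s : Finset ι)
    {B : (ι → ℝ) → ℝ} (hB : Measurable B) {b : ℝ} (hBb : ∀ w, |B w| ≤ b) (c : ι → ℝ)
    {f f' : ι → ℝ → ℝ} {K : ℝ} (hf : ∀ i x, HasDerivAt (f i) (f' i x) x)
    (hf1 : ∀ i x, |f i x| ≤ 1) (hfK : ∀ i x, |f' i x| ≤ K) (hfm : ∀ i, Measurable (f' i)) :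
    ∫ ω, G ω * (B (W ω) * ∏ k ∈ s, f k (c k * G ω + W ω k)) ∂P =
      ∑ j ∈ s, c j * ∫ ω, B (W ω) * (f' j (c j * G ω + W ω j) *
        ∏ k ∈ s.erase j, f k (c k * G ω + W ω k)) ∂P := by
  have hfm0 : ∀ i, Measurable (f i) := fun i =>
    (continuous_iff_continuousAt.2 fun x => (hf i x).continuousAt).measurable
  have hjoint : P.map (fun ω => (G ω, W ω)) = (gaussianReal 0 1).prod (P.map W) := by
    rw [(indepFun_iff_map_prod_eq_prod_map_map hG.aemeasurable hW.aemeasurable).1 hind, hlaw]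
  have : IsProbabilityMeasure (P.map W) := Measure.isProbabilityMeasure_map hW.aemeasurable
  have hb : 0 ≤ b := (abs_nonneg _).trans (hBb 0)
  have trans : ∀ F : ℝ × (ι → ℝ) → ℝ, Measurable F →
      ∫ ω, F (G ω, W ω) ∂P = ∫ p, F p ∂((gaussianReal 0 1).prod (P.map W)) := by
    intro F hF
    rw [← hjoint, integral_map (by fun_prop) hF.aestronglyMeasurable]
  have mprod : ∀ t : Finset ι,
      Measurable (fun p : ℝ × (ι → ℝ) => ∏ k ∈ t, f k (c k * p.1 + p.2 k)) := by
    intro t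
    refine Finset.measurable_fun_prod t fun k _ => (hfm0 k).comp ?_
    fun_prop
  have md : ∀ j, Measurable (fun p : ℝ × (ι → ℝ) => f' j (c j * p.1 + p.2 j)) := by
    intro j
    refine (hfm j).comp ?_
    fun_prop
  have mB : Measurable (fun p : ℝ × (ι → ℝ) => B p.2) := hB.comp measurable_snd
  have Fm : ∀ j, Measurable (fun p : ℝ × (ι → ℝ) => B p.2 * (f' j (c j * p.1 + p.2 j) *
        ∏ k ∈ s.erase j, f k (c k * p.1 + p.2 k))) := fun j => mB.mul ((md j).mul (mprod _))
  have F0 : Measurable (fun p : ℝ × (ι → ℝ) => p.1 * (B p.2 * ∏ k ∈ s, f k (c k * p.1 + p.2 k))) :=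
    measurable_fst.mul (mB.mul (mprod _))
  have Fb : ∀ j (p : ℝ × (ι → ℝ)), |B p.2 * (f' j (c j * p.1 + p.2 j) *
        ∏ k ∈ s.erase j, f k (c k * p.1 + p.2 k))| ≤ b * (K * 1) := by
    intro j p
    rw [abs_mul, abs_mul]
    have hK0 : 0 ≤ K := (abs_nonneg _).trans (hfK j 0)
    gcongr
    · exact hBb _
    · exact hfK _ _
    · exact abs_prod_le_one fun i => hf1 i _
  have Fi : ∀ j, Integrable (fun p : ℝ × (ι → ℝ) => B p.2 * (f' j (c j * p.1 + p.2 j) *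
        ∏ k ∈ s.erase j, f k (c k * p.1 + p.2 k))) ((gaussianReal 0 1).prod (P.map W)) := by
    intro j
    exact Integrable.of_bound (Fm j).aestronglyMeasurable _ (ae_of_all _ (Fb j))
  have F0i : Integrable (fun p : ℝ × (ι → ℝ) => p.1 * (B p.2 * ∏ k ∈ s, f k (c k * p.1 + p.2 k)))
      ((gaussianReal 0 1).prod (P.map W)) := by
    refine Integrable.mul_bdd (c := b * 1) ?_ (mB.mul (mprod _)).aestronglyMeasurable
      (ae_of_all _ fun p => ?_)
    · have : Integrable (fun x : ℝ => x) (gaussianReal 0 1) :=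
        memLp_one_iff_integrable.1 (memLp_id_gaussianReal 1)
      exact this.comp_fst (P.map W)
    · rw [norm_eq_abs, abs_mul]
      gcongr
      · exact hBb _
      · exact abs_prod_le_one fun i => hf1 i _
  rw [trans _ F0, integral_prod_symm _ F0i]
  simp_rw [fun j => trans _ (Fm j)]
  have : ∀ w : ι → ℝ, ∫ x, x * (B w * ∏ k ∈ s, f k (c k * x + w k)) ∂(gaussianReal 0 1) =
      ∫ x, ∑ j ∈ s, c j * (B w * (f' j (c j * x + w j) *
        ∏ k ∈ s.erase j, f k (c k * x + w k))) ∂(gaussianReal 0 1) := by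
    intro w
    have hd : ∀ x, HasDerivAt (fun x => B w * ∏ k ∈ s, f k (c k * x + w k))
        (∑ j ∈ s, c j * (B w * (f' j (c j * x + w j) *
        ∏ k ∈ s.erase j, f k (c k * x + w k)))) x := by
      intro x
      have h1 : ∀ k ∈ s,
          HasDerivAt (fun x => f k (c k * x + w k)) (f' k (c k * x + w k) * c k) x := by
        intro k _
        have h0 : HasDerivAt (fun x => c k * x + w k) (c k) x := by
          simpa using ((hasDerivAt_id x).const_mul (c k)).add_const (w k)
        exact (hf k (c k * x + w k)).comp x h0
      refine ((HasDerivAt.fun_finsetProd h1).const_mul (B w)).congr_deriv ?_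
      rw [Finset.mul_sum]
      refine Finset.sum_congr rfl fun j _ => ?_
      simp only [smul_eq_mul]
      ring
    refine integral_id_mul_gaussianReal (A := b * 1) (B := ∑ j ∈ s, |c j| * (b * (K * 1))) hd
      ?_ ?_ ?_
    · intro x
      rw [abs_mul]
      gcongr
      · exact hBb _
      · exact abs_prod_le_one fun i => hf1 i _
    · intro x
      refine (Finset.abs_sum_le_sum_abs _ _).trans (Finset.sum_le_sum fun j _ => ?_)
      rw [abs_mul]
      exact mul_le_mul_of_nonneg_left (Fb j (x, w)) (abs_nonneg _)
    · refine Finset.measurable_fun_sum s fun j _ => Measurable.const_mul ?_ _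
      exact (Fm j).comp (by fun_prop : Measurable fun x : ℝ => (x, w))
  simp_rw [this]
  rw [← integral_prod_symm (fun p : ℝ × (ι → ℝ) =>
    ∑ j ∈ s, c j * (B p.2 * (f' j (c j * p.1 + p.2 j) *
        ∏ k ∈ s.erase j, f k (c k * p.1 + p.2 k))))]
  · rw [integral_finsetSum]
    · simp_rw [integral_const_mul]
    · exact fun j _ => (Fi j).const_mul _
  · exact integrable_finsetSum _ fun j _ => (Fi j).const_mul _

end IBP

/-- Gaussian integration by parts for a product of functions of a Gaussian vector, in a direction
uncorrelated with one of the coordinates. -/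
lemma integral_mul_deriv_mul_prod {ι : Type*} [Fintype ι] {Ω : Type*} [MeasurableSpace Ω]
    {P : Measure Ω}
    [IsProbabilityMeasure P] {G : Ω → ℝ} {Z : Ω → ι → ℝ} (hG : Measurable G) (hZ : Measurable Z)
    (hlaw : P.map G = gaussianReal 0 1) (hGZ : HasGaussianLaw (fun ω => (G ω, Z ω)) P)
    {i : ι} (hi : cov[G, fun ω => Z ω i; P] = 0)
    {f f' : ι → ℝ → ℝ} {K : ℝ} (hf : ∀ i x, HasDerivAt (f i) (f' i x) x)
    (hf1 : ∀ i x, |f i x| ≤ 1) (hfK : ∀ i x, |f' i x| ≤ K) (hfm : ∀ i, Measurable (f' i)) :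
    ∫ ω, G ω * (f' i (Z ω i) * ∏ k ∈ Finset.univ.erase i, f k (Z ω k)) ∂P =
      ∑ j ∈ Finset.univ.erase i, cov[G, fun ω => Z ω j; P] * ∫ ω, f' i (Z ω i) *
        (f' j (Z ω j) * ∏ k ∈ (Finset.univ.erase i).erase j, f k (Z ω k)) ∂P := by
  set c : ι → ℝ := fun j => cov[G, fun ω => Z ω j; P] with hc
  set W : Ω → ι → ℝ := fun ω j => Z ω j - c j * G ω with hWdef
  have hW : Measurable W := by
    refine measurable_pi_lambda _ fun j => ?_
    fun_prop
  have hGg : HasGaussianLaw G P := hGZ.fst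
  have hZg : HasGaussianLaw (fun ω => (Z ω ·)) P := hGZ.snd
  have hG2 : MemLp G 2 P := hGg.memLp_two
  have hZ2 : ∀ j, MemLp (fun ω => Z ω j) 2 P := fun j => (hZg.eval j).memLp_two
  have hvar : Var[G; P] = 1 := by
    have h := variance_map (μ := P) (X := id) (Y := G) aemeasurable_id hG.aemeasurable
    rw [hlaw, variance_id_gaussianReal] at h
    simpa using h.symm
  have hind : IndepFun G W P := by
    let L : ℝ × (ι → ℝ) →L[ℝ] (Unit → ℝ) × (ι → ℝ) :=
      (ContinuousLinearMap.pi fun _ => ContinuousLinearMap.fst ℝ ℝ (ι → ℝ)).prod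
        (ContinuousLinearMap.pi fun j => (ContinuousLinearMap.proj j).comp
          (ContinuousLinearMap.snd ℝ ℝ (ι → ℝ)) - c j • ContinuousLinearMap.fst ℝ ℝ (ι → ℝ))
    have h : HasGaussianLaw (fun ω => ((fun _ : Unit => G ω), fun j => W ω j)) P := by
      exact hGZ.map_fun L
    have := HasGaussianLaw.indepFun_of_covariance_eval (X := fun _ : Unit => G)
      (Y := fun j ω => W ω j) h ?_
    · exact this.comp (φ := fun x : Unit → ℝ => x ()) (ψ := id) (measurable_pi_apply ())
        measurable_id
    · intro _ j
      rw [covariance_fun_sub_right hG2 (hZ2 j) (hG2.const_mul (c j)),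
        covariance_const_mul_right, covariance_self hG.aemeasurable, hvar]
      simp [hc]
  have key := integral_mul_prod_of_indepFun hG hW hlaw hind (Finset.univ.erase i)
    (B := fun w => f' i (w i)) ((hfm i).comp (measurable_pi_apply i)) (fun w => hfK i (w i)) c
    hf hf1 hfK hfm
  have e1 : ∀ ω k, c k * G ω + W ω k = Z ω k := fun ω k => by simp [hWdef]
  have e2 : ∀ ω, W ω i = Z ω i := fun ω => by simp [hWdef, hc, hi]
  simp only [e1, e2] at key
  exact key

/-- The interpolation bound: difference of product expectations of two independent Gaussian vectors
with unit variances. -/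
lemma abs_integral_prod_sub_le {ι : Type*} [Fintype ι] {Ω : Type*} [MeasurableSpace Ω]
    {P : Measure Ω} [IsProbabilityMeasure P] {X Y : Ω → ι → ℝ} (hX : Measurable X)
    (hY : Measurable Y) (hXY : HasGaussianLaw (fun ω => (X ω, Y ω)) P)
    (hX1 : ∀ i, P.map (fun ω => X ω i) = gaussianReal 0 1)
    (hY1 : ∀ i, P.map (fun ω => Y ω i) = gaussianReal 0 1)
    (hc0 : ∀ i j, cov[fun ω => X ω i, fun ω => Y ω j; P] = 0)
    {f f' : ι → ℝ → ℝ} {K : ℝ} (hf : ∀ i x, HasDerivAt (f i) (f' i x) x)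
    (hf1 : ∀ i x, |f i x| ≤ 1) (hfK : ∀ i x, |f' i x| ≤ K) (hfm : ∀ i, Measurable (f' i))
    {M : ι → ι → ℝ} (hM : ∀ i j, i ≠ j → ∀ θ : ℝ,
      ∫ ω, |f' i (sin θ * X ω i + cos θ * Y ω i)| * |f' j (sin θ * X ω j + cos θ * Y ω j)| ∂P
        ≤ M i j) :
    |∫ ω, ∏ i, f i (X ω i) ∂P - ∫ ω, ∏ i, f i (Y ω i) ∂P| ≤
      (∑ i, ∑ j ∈ Finset.univ.erase i, |cov[fun ω => X ω i, fun ω => X ω j; P] -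
        cov[fun ω => Y ω i, fun ω => Y ω j; P]| * M i j) * (π / 2) := by
  have hfm0 : ∀ i, Measurable (f i) := fun i =>
    (continuous_iff_continuousAt.2 fun x => (hf i x).continuousAt).measurable
  have hXg : HasGaussianLaw (fun ω => (X ω ·)) P := hXY.fst
  have hYg : HasGaussianLaw (fun ω => (Y ω ·)) P := hXY.snd
  have hX2 : ∀ j, MemLp (fun ω => X ω j) 2 P := fun j => (hXg.eval j).memLp_two
  have hY2 : ∀ j, MemLp (fun ω => Y ω j) 2 P := fun j => (hYg.eval j).memLp_two
  have hXm : ∀ j, Measurable (fun ω => X ω j) := fun j => (measurable_pi_apply j).comp hX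
  have hYm : ∀ j, Measurable (fun ω => Y ω j) := fun j => (measurable_pi_apply j).comp hY
  have hvar : ∀ U : Ω → ℝ, Measurable U → P.map U = gaussianReal 0 1 → Var[U; P] = 1 := by
    intro U hU hl
    have h := variance_map (μ := P) (X := id) (Y := U) aemeasurable_id hU.aemeasurable
    rw [hl, variance_id_gaussianReal] at h
    simpa using h.symm
  have hmean : ∀ U : Ω → ℝ, Measurable U → P.map U = gaussianReal 0 1 → P[U] = 0 := by
    intro U hU hl
    have h := integral_map (μ := P) (φ := U) hU.aemeasurable (f := fun x => x)
      (measurable_id.aestronglyMeasurable)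
    rw [hl, integral_id_gaussianReal] at h
    exact h.symm
  set Z : ℝ → Ω → ι → ℝ := fun θ ω k => sin θ * X ω k + cos θ * Y ω k with hZdef
  set D : ℝ → Ω → ι → ℝ := fun θ ω k => cos θ * X ω k - sin θ * Y ω k with hDdef
  have hZm : ∀ θ, Measurable (Z θ) := fun θ => measurable_pi_lambda _ fun j =>
    ((hXm j).const_mul _).add ((hYm j).const_mul _)
  have hZmj : ∀ θ j, Measurable (fun ω => Z θ ω j) := fun θ j =>
    ((hXm j).const_mul _).add ((hYm j).const_mul _)
  have hDm : ∀ θ j, Measurable (fun ω => D θ ω j) := fun θ j =>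
    ((hXm j).const_mul _).sub ((hYm j).const_mul _)
  set F : ℝ → Ω → ℝ := fun θ ω => ∏ k, f k (Z θ ω k) with hF
  set F' : ℝ → Ω → ℝ := fun θ ω =>
    ∑ i, D θ ω i * (f' i (Z θ ω i) * ∏ k ∈ Finset.univ.erase i, f k (Z θ ω k)) with hF'
  have termm : ∀ θ i, Measurable (fun ω =>
      f' i (Z θ ω i) * ∏ k ∈ Finset.univ.erase i, f k (Z θ ω k)) := by
    intro θ i
    refine ((hfm i).comp (hZmj θ i)).mul ?_
    exact Finset.measurable_fun_prod _ fun k _ => (hfm0 k).comp (hZmj θ k)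
  have termb : ∀ θ i ω,
      |f' i (Z θ ω i) * ∏ k ∈ Finset.univ.erase i, f k (Z θ ω k)| ≤ K := by
    intro θ i ω
    rw [abs_mul]
    calc _ ≤ K * 1 := mul_le_mul (hfK _ _) (abs_prod_le_one fun i => hf1 i _) (abs_nonneg _)
            ((abs_nonneg _).trans (hfK i 0))
      _ = K := mul_one _
  have hFd : ∀ θ ω, HasDerivAt (fun θ => F θ ω) (F' θ ω) θ := by
    intro θ ω
    have h1 : ∀ k ∈ Finset.univ,
        HasDerivAt (fun θ => f k (Z θ ω k)) (f' k (Z θ ω k) * D θ ω k) θ := by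
      intro k _
      have h0 : HasDerivAt (fun θ => Z θ ω k) (D θ ω k) θ := by
        refine (((hasDerivAt_sin θ).mul_const (X ω k)).fun_add
          ((hasDerivAt_cos θ).mul_const (Y ω k))).congr_deriv ?_
        simp only [hDdef]; ring
      exact (hf k (Z θ ω k)).comp θ h0
    refine (HasDerivAt.fun_finsetProd h1).congr_deriv ?_
    refine Finset.sum_congr rfl fun j _ => ?_
    simp only [smul_eq_mul]
    ring
  have hDb : ∀ θ ω i, |D θ ω i| ≤ |X ω i| + |Y ω i| := by
    intro θ ω i
    refine (abs_sub _ _).trans ?_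
    rw [abs_mul, abs_mul]
    exact add_le_add (mul_le_of_le_one_left (abs_nonneg _) (abs_cos_le_one _))
      (mul_le_of_le_one_left (abs_nonneg _) (abs_sin_le_one _))
  have hder : ∀ θ, HasDerivAt (fun θ => ∫ ω, F θ ω ∂P) (∫ ω, F' θ ω ∂P) θ := by
    intro θ
    refine (hasDerivAt_integral_of_dominated_loc_of_deriv_le (F := F) (F' := F') (s := Set.univ)
      (bound := fun ω => ∑ i, (|X ω i| + |Y ω i|) * K) univ_mem ?_ ?_ ?_ ?_ ?_ ?_).2
    · exact Eventually.of_forall fun θ => (Finset.measurable_fun_prod _ fun k _ =>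
        (hfm0 k).comp (hZmj θ k)).aestronglyMeasurable
    · refine Integrable.of_bound (Finset.measurable_fun_prod _ fun k _ =>
        (hfm0 k).comp (hZmj θ k)).aestronglyMeasurable 1 (ae_of_all _ fun ω => ?_)
      exact abs_prod_le_one fun i => hf1 i _
    · exact (Finset.measurable_fun_sum _ fun i _ => (hDm θ i).mul (termm θ i)).aestronglyMeasurable
    · refine ae_of_all _ fun ω θ _ => ?_
      refine (norm_sum_le _ _).trans (Finset.sum_le_sum fun i _ => ?_)
      rw [norm_mul, norm_eq_abs, norm_eq_abs]
      exact mul_le_mul (hDb θ ω i) (termb θ i ω) (abs_nonneg _) (by positivity)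
    · refine integrable_finsetSum _ fun i _ => Integrable.mul_const ?_ _
      exact ((hX2 i).integrable (by norm_num)).abs.add ((hY2 i).integrable (by norm_num)).abs
    · exact ae_of_all _ fun ω θ _ => hFd θ ω
  have hDg : ∀ θ i, HasGaussianLaw (fun ω => (D θ ω i, Z θ ω)) P := by
    intro θ i
    let L : (ι → ℝ) × (ι → ℝ) →L[ℝ] ℝ × (ι → ℝ) :=
      ((cos θ • (ContinuousLinearMap.proj i).comp (ContinuousLinearMap.fst ℝ (ι → ℝ) (ι → ℝ))) -
        (sin θ • (ContinuousLinearMap.proj i).comp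
          (ContinuousLinearMap.snd ℝ (ι → ℝ) (ι → ℝ)))).prod
        (sin θ • ContinuousLinearMap.fst ℝ (ι → ℝ) (ι → ℝ) +
          cos θ • ContinuousLinearMap.snd ℝ (ι → ℝ) (ι → ℝ))
    exact hXY.map_fun L
  have hXc : ∀ (a : ℝ) i, MemLp (fun ω => a * X ω i) 2 P := fun a i => (hX2 i).const_mul a
  have hYc : ∀ (a : ℝ) i, MemLp (fun ω => a * Y ω i) 2 P := fun a i => (hY2 i).const_mul a
  have hcov : ∀ θ i j, cov[fun ω => D θ ω i, fun ω => Z θ ω j; P] =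
      cos θ * sin θ * (cov[fun ω => X ω i, fun ω => X ω j; P] -
        cov[fun ω => Y ω i, fun ω => Y ω j; P]) := by
    intro θ i j
    have hc0' : cov[fun ω => Y ω i, fun ω => X ω j; P] = 0 := by
      rw [covariance_comm]; exact hc0 j i
    have hZ2 : MemLp (fun ω => sin θ * X ω j + cos θ * Y ω j) 2 P := (hXc _ _).add (hYc _ _)
    simp only [hDdef, hZdef]
    rw [covariance_fun_sub_left (hXc _ _) (hYc _ _) hZ2]
    erw [covariance_add_right (hXc _ _) (hXc _ _) (hYc _ _),
      covariance_add_right (hYc _ _) (hXc _ _) (hYc _ _)]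
    simp only [covariance_const_mul_left, covariance_const_mul_right, hc0, hc0']
    ring
  have hDlaw : ∀ θ i, P.map (fun ω => D θ ω i) = gaussianReal 0 1 := by
    intro θ i
    have hg : HasGaussianLaw (fun ω => D θ ω i) P := (hDg θ i).fst
    rw [hg.map_eq_gaussianReal]
    have m0 : P[fun ω => D θ ω i] = 0 := by
      simp only [hDdef]
      rw [integral_sub ((hXc _ _).integrable (by norm_num)) ((hYc _ _).integrable (by norm_num)),
        integral_const_mul, integral_const_mul, hmean _ (hXm i) (hX1 i), hmean _ (hYm i) (hY1 i)]
      simp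
    have v1 : Var[fun ω => D θ ω i; P] = 1 := by
      simp only [hDdef]
      rw [variance_fun_sub (hXc _ _) (hYc _ _), variance_const_mul, variance_const_mul,
        covariance_const_mul_left, covariance_const_mul_right, hc0, hvar _ (hXm i) (hX1 i),
        hvar _ (hYm i) (hY1 i)]
      simp
    rw [m0, v1]
    simp
  have hder' : ∀ θ, ‖∫ ω, F' θ ω ∂P‖ ≤
      ∑ i, ∑ j ∈ Finset.univ.erase i, |cov[fun ω => X ω i, fun ω => X ω j; P] -
        cov[fun ω => Y ω i, fun ω => Y ω j; P]| * M i j := by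
    intro θ
    have hii : ∀ i, cov[fun ω => D θ ω i, fun ω => Z θ ω i; P] = 0 := by
      intro i
      rw [hcov, covariance_self (hXm i).aemeasurable, covariance_self (hYm i).aemeasurable,
        hvar _ (hXm i) (hX1 i), hvar _ (hYm i) (hY1 i)]
      simp
    simp only [hF']
    rw [integral_finsetSum]
    swap
    · intro i _
      refine Integrable.mul_bdd (c := K) (((hDg θ i).fst).integrable)
        (termm θ i).aestronglyMeasurable (ae_of_all _ (termb θ i))
    refine (norm_sum_le _ _).trans (Finset.sum_le_sum fun i _ => ?_)
    rw [integral_mul_deriv_mul_prod (hDm θ i) (hZm θ) (hDlaw θ i) (hDg θ i) (hii i) hf hf1 hfK hfm]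
    refine (norm_sum_le _ _).trans (Finset.sum_le_sum fun j hj => ?_)
    have hij : i ≠ j := fun h => (Finset.ne_of_mem_erase hj) h.symm
    rw [norm_mul, hcov, norm_eq_abs, abs_mul]
    refine mul_le_mul ?_ ?_ (norm_nonneg _) (abs_nonneg _)
    · refine mul_le_of_le_one_left (abs_nonneg _) ?_
      rw [abs_mul]
      exact mul_le_one₀ (abs_cos_le_one _) (abs_nonneg _) (abs_sin_le_one _)
    · refine (norm_integral_le_integral_norm _).trans (le_trans ?_ (hM i j hij θ))
      have mm : ∀ i, Measurable fun ω => |f' i (Z θ ω i)| := fun i =>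
        ((hfm i).comp (hZmj θ i)).norm
      have hprodle : ∀ ω, ‖f' i (Z θ ω i) * (f' j (Z θ ω j) *
          ∏ k ∈ (Finset.univ.erase i).erase j, f k (Z θ ω k))‖ ≤
          |f' i (Z θ ω i)| * |f' j (Z θ ω j)| := by
        intro ω
        rw [norm_mul, norm_mul, norm_eq_abs, norm_eq_abs, norm_eq_abs]
        refine mul_le_mul_of_nonneg_left ?_ (abs_nonneg _)
        exact mul_le_of_le_one_right (abs_nonneg _) (abs_prod_le_one fun i => hf1 i _)
      refine integral_mono_of_nonneg (ae_of_all _ fun ω => norm_nonneg _) ?_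
        (ae_of_all _ hprodle)
      refine Integrable.of_bound ((mm i).mul (mm j)).aestronglyMeasurable (K * K)
        (ae_of_all _ fun ω => ?_)
      rw [norm_eq_abs, abs_mul, abs_abs, abs_abs]
      exact mul_le_mul (hfK _ _) (hfK _ _) (abs_nonneg _) ((abs_nonneg _).trans (hfK i 0))
  have := (convex_Icc (0 : ℝ) (π / 2)).norm_image_sub_le_of_norm_hasDerivWithin_le
    (fun θ _ => (hder θ).hasDerivWithinAt) (fun θ _ => hder' θ)
    (Set.left_mem_Icc.2 (by positivity)) (Set.right_mem_Icc.2 (by positivity))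
  simpa [hF, hZdef, abs_of_pos pi_pos] using this

/-- Pointwise bound for the bivariate normal density in the quadrant `[v, ∞)²`. -/
lemma gaussianPDFReal_mul_le {ω w v x y : ℝ} {s : ℝ≥0} (hs : (s : ℝ) = 1 - ω ^ 2) (hω : |ω| ≤ w)
    (hw : w < 1) (hv : 0 ≤ v) (hx : v ≤ x) (hy : v ≤ ω * x + y) :
    gaussianPDFReal 0 1 x * gaussianPDFReal 0 s y ≤
      (√(1 - w ^ 2))⁻¹ * rexp (-(v ^ 2 / (1 + w))) := by
  obtain ⟨h1, h2⟩ := abs_le.1 hω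
  have hw0 : 0 ≤ w := (abs_nonneg _).trans hω
  have hw2 : 0 < 1 - w ^ 2 := by nlinarith
  have hsw : 1 - w ^ 2 ≤ s := by rw [hs]; nlinarith [sq_le_sq.2 (hω.trans (le_abs_self w))]
  have hs0 : (0 : ℝ) < s := hw2.trans_le hsw
  have hpi : 1 ≤ 2 * π := by linarith [pi_gt_three]
  have hexp : -x ^ 2 / 2 + -y ^ 2 / (2 * s) ≤ -(v ^ 2 / (1 + w)) := by
    have e1 : v ^ 2 / (1 + w) ≤ v ^ 2 / (1 + ω) := by
      apply div_le_div_of_nonneg_left (sq_nonneg v) (by linarith) (by linarith)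
    have e2 : v ^ 2 / (1 + ω) ≤ x ^ 2 / 2 + y ^ 2 / (2 * s) := by
      have e3 : v ^ 2 / (1 + ω) = (2 * (1 - ω) * v ^ 2) / (2 * s) := by
        rw [hs]
        have : 1 + ω ≠ 0 := by linarith
        have : 1 - ω ≠ 0 := by linarith
        rw [show 1 - ω ^ 2 = (1 - ω) * (1 + ω) by ring]
        field_simp
      have e4 : x ^ 2 / 2 + y ^ 2 / (2 * s) = (s * x ^ 2 + y ^ 2) / (2 * s) := by
        field_simp
      rw [e3, e4]
      refine div_le_div_of_nonneg_right ?_ (by linarith)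
      rw [hs]
      set Y := ω * x + y with hY
      have hy' : y = Y - ω * x := by rw [hY]; ring
      rw [hy']
      have h5 : (2 * v) ^ 2 ≤ (x + Y) ^ 2 := by
        apply pow_le_pow_left₀ (by linarith) (by linarith)
      nlinarith [mul_le_mul_of_nonneg_left h5 (by linarith : (0 : ℝ) ≤ 1 - ω),
        mul_nonneg (by linarith : (0 : ℝ) ≤ 1 + ω) (sq_nonneg (x - Y))]
    have e5 : -x ^ 2 / 2 + -y ^ 2 / (2 * s) = -(x ^ 2 / 2 + y ^ 2 / (2 * s)) := by ring
    rw [e5]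
    linarith
  have hform : gaussianPDFReal 0 1 x * gaussianPDFReal 0 s y =
      ((√(2 * π))⁻¹ * (√(2 * π * s))⁻¹) * rexp (-x ^ 2 / 2 + -y ^ 2 / (2 * s)) := by
    rw [exp_add]
    simp only [gaussianPDFReal, NNReal.coe_one, mul_one, sub_zero]
    ring
  rw [hform]
  refine mul_le_mul ?_ (exp_le_exp.2 hexp) (exp_pos _).le (by positivity)
  rw [← one_mul (√(1 - w ^ 2))⁻¹]
  refine mul_le_mul ?_ ?_ (by positivity) zero_le_one
  · exact inv_le_one_of_one_le₀ (one_le_sqrt.2 hpi)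
  · refine inv_anti₀ (sqrt_pos.2 hw2) (sqrt_le_sqrt ?_)
    nlinarith

/-- Small-square bound for the bivariate normal law. -/
lemma measure_bivariate_le {Ω : Type*} [MeasurableSpace Ω] {P : Measure Ω} [IsProbabilityMeasure P]
    {U V : Ω → ℝ} (hU : Measurable U) (hV : Measurable V)
    (hUV : HasGaussianLaw (fun ω => (U ω, V ω)) P)
    (hU1 : P.map U = gaussianReal 0 1) (hV1 : P.map V = gaussianReal 0 1)
    {w v δ a b : ℝ} (hc : |cov[U, V; P]| ≤ w) (hw : w < 1) (hv : 0 ≤ v) (hδ : 0 ≤ δ) (ha : v ≤ a)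
    (hb : v ≤ b) :
    P.real {ω | U ω ∈ Set.Icc a (a + δ) ∧ V ω ∈ Set.Icc b (b + δ)} ≤
      δ ^ 2 * ((√(1 - w ^ 2))⁻¹ * rexp (-(v ^ 2 / (1 + w)))) := by
  set c := cov[U, V; P] with hcdef
  set C := (√(1 - w ^ 2))⁻¹ * rexp (-(v ^ 2 / (1 + w))) with hC
  have hC0 : 0 ≤ C := by positivity
  have hU2 : MemLp U 2 P := hUV.fst.memLp_two
  have hV2 : MemLp V 2 P := hUV.snd.memLp_two
  have hvar : ∀ U : Ω → ℝ, Measurable U → P.map U = gaussianReal 0 1 → Var[U; P] = 1 := by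
    intro U hU hl
    have h := variance_map (μ := P) (X := id) (Y := U) aemeasurable_id hU.aemeasurable
    rw [hl, variance_id_gaussianReal] at h
    simpa using h.symm
  have hmean : ∀ U : Ω → ℝ, Measurable U → P.map U = gaussianReal 0 1 → P[U] = 0 := by
    intro U hU hl
    have h := integral_map (μ := P) (φ := U) hU.aemeasurable (f := fun x => x)
      (measurable_id.aestronglyMeasurable)
    rw [hl, integral_id_gaussianReal] at h
    exact h.symm
  set W : Ω → ℝ := fun ω => V ω - c * U ω with hWdef
  have hW : Measurable W := hV.sub (hU.const_mul c)
  let L : ℝ × ℝ →L[ℝ] ℝ × ℝ := (ContinuousLinearMap.fst ℝ ℝ ℝ).prod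
    (ContinuousLinearMap.snd ℝ ℝ ℝ - c • ContinuousLinearMap.fst ℝ ℝ ℝ)
  have hUW : HasGaussianLaw (fun ω => (U ω, W ω)) P := hUV.map_fun L
  have hind : IndepFun U W P := by
    refine hUW.indepFun_of_covariance_eq_zero ?_
    rw [covariance_fun_sub_right hU2 hV2 (hU2.const_mul c), covariance_const_mul_right,
      covariance_self hU.aemeasurable, hvar U hU hU1]
    simp [hcdef]
  set s : ℝ≥0 := (1 - c ^ 2).toNNReal with hsdef
  obtain ⟨hc1, hc2⟩ := abs_le.1 hc
  have hs0 : 0 < 1 - c ^ 2 := by nlinarith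
  have hs : (s : ℝ) = 1 - c ^ 2 := coe_toNNReal _ hs0.le
  have hsne : s ≠ 0 := by
    intro h; rw [h] at hs; simp at hs; linarith
  have hWlaw : P.map W = gaussianReal 0 s := by
    have hg : HasGaussianLaw W P := hUW.snd
    rw [hg.map_eq_gaussianReal]
    have m0 : P[W] = 0 := by
      simp only [hWdef]
      rw [integral_sub (hV2.integrable (by norm_num)) ((hU2.const_mul c).integrable (by norm_num)),
        integral_const_mul, hmean U hU hU1, hmean V hV hV1]
      simp
    have v1 : Var[W; P] = 1 - c ^ 2 := by
      simp only [hWdef]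
      rw [variance_fun_sub hV2 (hU2.const_mul c), variance_const_mul, covariance_const_mul_right,
        covariance_comm, hvar U hU hU1, hvar V hV hV1, ← hcdef]
      ring
    rw [m0, v1]
  have hjoint : P.map (fun ω => (U ω, W ω)) = (gaussianReal 0 1).prod (gaussianReal 0 s) := by
    rw [(indepFun_iff_map_prod_eq_prod_map_map hU.aemeasurable hW.aemeasurable).1 hind, hU1, hWlaw]
  set S : Set (ℝ × ℝ) := {p | p.1 ∈ Set.Icc a (a + δ) ∧ c * p.1 + p.2 ∈ Set.Icc b (b + δ)} with hS
  have hSm : MeasurableSet S :=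
    (measurable_fst measurableSet_Icc).inter
      ((by fun_prop : Measurable fun p : ℝ × ℝ => c * p.1 + p.2) measurableSet_Icc)
  have hset : {ω | U ω ∈ Set.Icc a (a + δ) ∧ V ω ∈ Set.Icc b (b + δ)} =
      (fun ω => (U ω, W ω)) ⁻¹' S := by
    ext ω
    simp [hS, hWdef]
  rw [hset, ← map_measureReal_apply (by fun_prop) hSm, hjoint, Measure.real]
  refine ENNReal.toReal_le_of_le_ofReal (by positivity) ?_
  rw [Measure.prod_apply hSm]
  have hlin : ∫⁻ x, gaussianReal 0 s (Prod.mk x ⁻¹' S) ∂(gaussianReal 0 1) =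
      ∫⁻ x, gaussianPDF 0 1 x * gaussianReal 0 s (Prod.mk x ⁻¹' S) := by
    rw [gaussianReal_of_var_ne_zero 0 one_ne_zero,
      lintegral_withDensity_eq_lintegral_mul _ (measurable_gaussianPDF 0 1)
        (measurable_measure_prodMk_left hSm)]
    rfl
  rw [hlin]
  have hpt : ∀ x, gaussianPDF 0 1 x * gaussianReal 0 s (Prod.mk x ⁻¹' S) ≤
      (Set.Icc a (a + δ)).indicator (fun _ => ENNReal.ofReal (C * δ)) x := by
    intro x
    by_cases hx : x ∈ Set.Icc a (a + δ)
    · rw [Set.indicator_of_mem hx]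
      have hpre : Prod.mk x ⁻¹' S = Set.Icc (b - c * x) (b - c * x + δ) := by
        ext y
        change (x ∈ Set.Icc a (a + δ) ∧ c * x + y ∈ Set.Icc b (b + δ)) ↔ _
        rw [and_iff_right hx, Set.mem_Icc, Set.mem_Icc]
        constructor
        · rintro ⟨h1, h2⟩; constructor <;> linarith
        · rintro ⟨h1, h2⟩; constructor <;> linarith
      rw [hpre, gaussianReal_apply 0 hsne, ← lintegral_const_mul _ (measurable_gaussianPDF 0 s)]
      calc _ ≤ ∫⁻ y in Set.Icc (b - c * x) (b - c * x + δ), ENNReal.ofReal C := by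
            refine setLIntegral_mono measurable_const fun y hy => ?_
            rw [gaussianPDF, gaussianPDF, ← ENNReal.ofReal_mul (gaussianPDFReal_nonneg _ _ _)]
            refine ENNReal.ofReal_le_ofReal ?_
            exact gaussianPDFReal_mul_le hs hc hw hv (ha.trans hx.1) (by linarith [hy.1])
        _ = ENNReal.ofReal (C * δ) := by
            rw [setLIntegral_const, Real.volume_Icc, add_sub_cancel_left, ENNReal.ofReal_mul hC0]
    · rw [Set.indicator_of_notMem hx]
      have hpre : Prod.mk x ⁻¹' S = ∅ := by
        ext y
        simp only [hS, Set.mem_preimage, Set.mem_ofPred_eq, hx, false_and, Set.mem_empty_iff_false]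
      simp [hpre]
  refine (lintegral_mono hpt).trans ?_
  rw [lintegral_indicator measurableSet_Icc, setLIntegral_const, Real.volume_Icc,
    add_sub_cancel_left, ← ENNReal.ofReal_mul (by positivity)]
  refine ENNReal.ofReal_le_ofReal (le_of_eq ?_)
  ring

lemma exists_abs_deriv_smoothTransition_le :
    ∃ K, 0 ≤ K ∧ ∀ x, |deriv smoothTransition x| ≤ K * (Set.Icc (0 : ℝ) 1).indicator 1 x := by
  have hc : Continuous (deriv smoothTransition) :=
    (smoothTransition.contDiff (n := 1)).continuous_deriv le_rfl
  obtain ⟨K, hK⟩ := isCompact_Icc.exists_bound_of_continuousOn (s := Set.Icc (0 : ℝ) 1)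
    hc.continuousOn
  refine ⟨K, (norm_nonneg _).trans (hK 0 (by simp)), fun x => ?_⟩
  by_cases hx : x ∈ Set.Icc (0 : ℝ) 1
  · simpa [hx] using hK x hx
  · rw [Set.indicator_of_notMem hx]
    have : deriv smoothTransition x = 0 := by
      rcases lt_or_ge x 0 with h | h
      · have : smoothTransition =ᶠ[nhds x] fun _ => 0 := by
          filter_upwards [Iio_mem_nhds h] with y hy
          exact smoothTransition.zero_of_nonpos (le_of_lt hy)
        rw [this.deriv_eq]; simp
      · have h1 : 1 < x := by
          by_contra h1
          exact hx ⟨h, not_lt.1 h1⟩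
        have : smoothTransition =ᶠ[nhds x] fun _ => 1 := by
          filter_upwards [Ioi_mem_nhds h1] with y hy
          exact smoothTransition.one_of_one_le (le_of_lt hy)
        rw [this.deriv_eq]; simp
    simp [this]

lemma integral_abs_mul_abs_le_of_bivariate {Ω : Type*} [MeasurableSpace Ω] {P : Measure Ω}
    [IsProbabilityMeasure P] {U V : Ω → ℝ} (hU : Measurable U) (hV : Measurable V)
    (hUV : HasGaussianLaw (fun ω => (U ω, V ω)) P)
    (hU1 : P.map U = gaussianReal 0 1) (hV1 : P.map V = gaussianReal 0 1)
    {w δ u u' K : ℝ} (hc : |cov[U, V; P]| ≤ w) (hw : w < 1) (hu : 0 ≤ u) (huu : u ≤ u')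
    (hδ : 0 < δ) {F G : ℝ → ℝ}
    (hF : ∀ x, |F x| ≤ K / δ * ((Set.Icc u (u + δ)).indicator 1 x +
      (Set.Icc u' (u' + δ)).indicator 1 x))
    (hG : ∀ x, |G x| ≤ K / δ * ((Set.Icc u (u + δ)).indicator 1 x +
      (Set.Icc u' (u' + δ)).indicator 1 x)) :
    ∫ ω, |F (U ω)| * |G (V ω)| ∂P ≤
      4 * K ^ 2 * ((√(1 - w ^ 2))⁻¹ * rexp (-(u ^ 2 / (1 + w)))) := by
  set C := (√(1 - w ^ 2))⁻¹ * rexp (-(u ^ 2 / (1 + w)))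
  let S : ℝ → ℝ → Set Ω := fun a b => {ω | U ω ∈ Set.Icc a (a + δ) ∧ V ω ∈ Set.Icc b (b + δ)}
  have hSm : ∀ a b, MeasurableSet (S a b) := fun a b =>
    (hU measurableSet_Icc).inter (hV measurableSet_Icc)
  have hS : ∀ a b, u ≤ a → u ≤ b → ∫ ω, (S a b).indicator (1 : Ω → ℝ) ω ∂P ≤ δ ^ 2 * C := by
    intro a b ha hb
    rw [integral_indicator_one (hSm a b)]
    exact measure_bivariate_le hU hV hUV hU1 hV1 hc hw hu hδ.le ha hb
  have hSi : ∀ a b, Integrable ((S a b).indicator (1 : Ω → ℝ)) P := fun a b =>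
    (integrable_const (1 : ℝ)).indicator (hSm a b)
  have hind : ∀ a b ω, (Set.Icc a (a + δ)).indicator (1 : ℝ → ℝ) (U ω) *
      (Set.Icc b (b + δ)).indicator (1 : ℝ → ℝ) (V ω) = (S a b).indicator (1 : Ω → ℝ) ω := by
    intro a b ω
    by_cases h1 : U ω ∈ Set.Icc a (a + δ) <;> by_cases h2 : V ω ∈ Set.Icc b (b + δ)
    · rw [Set.indicator_of_mem h1, Set.indicator_of_mem h2,
        Set.indicator_of_mem (show ω ∈ S a b from ⟨h1, h2⟩)]; simp
    · rw [Set.indicator_of_notMem h2, Set.indicator_of_notMem fun h : ω ∈ S a b => h2 h.2]; simp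
    · rw [Set.indicator_of_notMem h1, Set.indicator_of_notMem fun h : ω ∈ S a b => h1 h.1]; simp
    · rw [Set.indicator_of_notMem h1, Set.indicator_of_notMem fun h : ω ∈ S a b => h1 h.1]; simp
  calc ∫ ω, |F (U ω)| * |G (V ω)| ∂P
      ≤ ∫ ω, (K / δ) ^ 2 * (((S u u).indicator (1 : Ω → ℝ) ω + (S u u').indicator (1 : Ω → ℝ) ω) +
          ((S u' u).indicator (1 : Ω → ℝ) ω + (S u' u').indicator (1 : Ω → ℝ) ω)) ∂P := by
        refine integral_mono_of_nonneg (ae_of_all _ fun ω => by positivity)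
          (((hSi _ _).add (hSi _ _)).add ((hSi _ _).add (hSi _ _)) |>.const_mul _)
          (ae_of_all _ fun ω => ?_)
        refine (mul_le_mul (hF (U ω)) (hG (V ω)) (abs_nonneg _)
          ((abs_nonneg _).trans (hF (U ω)))).trans (le_of_eq ?_)
        simp only [← hind]
        ring
    _ = (K / δ) ^ 2 * ((∫ ω, (S u u).indicator (1 : Ω → ℝ) ω ∂P +
          ∫ ω, (S u u').indicator (1 : Ω → ℝ) ω ∂P) +
          (∫ ω, (S u' u).indicator (1 : Ω → ℝ) ω ∂P +
          ∫ ω, (S u' u').indicator (1 : Ω → ℝ) ω ∂P)) := by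
        rw [integral_const_mul, ← integral_add (hSi _ _) (hSi _ _),
          ← integral_add (hSi _ _) (hSi _ _)]
        exact congrArg _ (integral_add ((hSi _ _).add (hSi _ _)) ((hSi _ _).add (hSi _ _)))
    _ ≤ (K / δ) ^ 2 * ((δ ^ 2 * C + δ ^ 2 * C) + (δ ^ 2 * C + δ ^ 2 * C)) := by
        gcongr
        · exact hS _ _ le_rfl le_rfl
        · exact hS _ _ le_rfl huu
        · exact hS _ _ huu le_rfl
        · exact hS _ _ huu huu
    _ = 4 * K ^ 2 * C := by field_simp; ring

/-- The step function with jumps `-a` at `u` and `-b` at `u'`. -/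
noncomputable def stepFun (a b u u' x : ℝ) : ℝ :=
  1 - a * (Set.Ioi u).indicator 1 x - b * (Set.Ioi u').indicator 1 x

lemma measurable_stepFun (a b u u' : ℝ) : Measurable (stepFun a b u u') := by
  unfold stepFun
  have h : ∀ v : ℝ, Measurable ((Set.Ioi v).indicator (1 : ℝ → ℝ)) := fun v =>
    measurable_one.indicator measurableSet_Ioi
  exact (measurable_const.sub ((h u).const_mul a)).sub ((h u').const_mul b)

/-- Smooth version of `stepFun` at scale `δ`. -/
noncomputable def smoothStepFun (a b u u' δ x : ℝ) : ℝ :=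
  1 - a * smoothTransition ((x - u) / δ) - b * smoothTransition ((x - u') / δ)

lemma abs_smoothStepFun_le {a b : ℝ} (ha : 0 ≤ a) (hb : 0 ≤ b) (hab : a + b ≤ 1) (u u' δ x : ℝ) :
    |smoothStepFun a b u u' δ x| ≤ 1 := by
  unfold smoothStepFun
  have h1 := smoothTransition.nonneg ((x - u) / δ)
  have h2 := smoothTransition.nonneg ((x - u') / δ)
  have h3 := smoothTransition.le_one ((x - u) / δ)
  have h4 := smoothTransition.le_one ((x - u') / δ)
  rw [abs_le]
  constructor <;> nlinarith [mul_nonneg ha h1, mul_nonneg hb h2, mul_le_mul_of_nonneg_left h3 ha,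
    mul_le_mul_of_nonneg_left h4 hb]

lemma hasDerivAt_smoothStepFun (a b u u' δ x : ℝ) :
    HasDerivAt (smoothStepFun a b u u' δ)
      (-(a * (deriv smoothTransition ((x - u) / δ) / δ)) -
        b * (deriv smoothTransition ((x - u') / δ) / δ)) x := by
  have h : ∀ v : ℝ, HasDerivAt (fun x => smoothTransition ((x - v) / δ))
      (deriv smoothTransition ((x - v) / δ) / δ) x := by
    intro v
    have h1 : HasDerivAt smoothTransition (deriv smoothTransition ((x - v) / δ)) ((x - v) / δ) :=
      ((smoothTransition.contDiff (n := 1)).differentiable (by norm_num) _).hasDerivAt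
    have h2 : HasDerivAt (fun x : ℝ => (x - v) / δ) (1 / δ) x :=
      ((hasDerivAt_id x).sub_const v).div_const δ
    exact (h1.comp x h2).congr_deriv (mul_one_div _ _)
  exact ((((h u).const_mul a).const_sub 1).sub ((h u').const_mul b))

lemma abs_deriv_smoothStepFun_le {K a b δ : ℝ} (ha : 0 ≤ a) (hb : 0 ≤ b) (hab : a + b ≤ 1)
    (hδ : 0 < δ)
    (hK : ∀ x, |deriv smoothTransition x| ≤ K * (Set.Icc (0 : ℝ) 1).indicator 1 x) (u u' x : ℝ) :
    |-(a * (deriv smoothTransition ((x - u) / δ) / δ)) -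
        b * (deriv smoothTransition ((x - u') / δ) / δ)| ≤
      K / δ * ((Set.Icc u (u + δ)).indicator 1 x + (Set.Icc u' (u' + δ)).indicator 1 x) := by
  have h : ∀ v : ℝ, |deriv smoothTransition ((x - v) / δ) / δ| ≤
      K / δ * (Set.Icc v (v + δ)).indicator 1 x := by
    intro v
    rw [abs_div, abs_of_pos hδ, div_mul_eq_mul_div]
    refine div_le_div_of_nonneg_right ((hK _).trans (le_of_eq ?_)) hδ.le
    congr 1
    have : (x - v) / δ ∈ Set.Icc (0 : ℝ) 1 ↔ x ∈ Set.Icc v (v + δ) := by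
      rw [Set.mem_Icc, Set.mem_Icc, div_le_one hδ, le_div_iff₀ hδ]
      constructor <;> rintro ⟨h1, h2⟩ <;> constructor <;> linarith
    simp only [Set.indicator_apply, this, Pi.one_apply]
  refine (abs_sub _ _).trans ?_
  rw [abs_neg, abs_mul, abs_mul, abs_of_nonneg ha, abs_of_nonneg hb, mul_add]
  exact add_le_add ((mul_le_of_le_one_left (abs_nonneg _) (by linarith)).trans (h u))
    ((mul_le_of_le_one_left (abs_nonneg _) (by linarith)).trans (h u'))

lemma tendsto_smoothStepFun (a b u u' x : ℝ) {δ : ℕ → ℝ} (hδ : ∀ n, 0 < δ n)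
    (hδ0 : Tendsto δ atTop (nhds 0)) :
    Tendsto (fun n => smoothStepFun a b u u' (δ n) x) atTop (nhds (stepFun a b u u' x)) := by
  have h : ∀ v : ℝ, Tendsto (fun n => smoothTransition ((x - v) / δ n)) atTop
      (nhds ((Set.Ioi v).indicator 1 x)) := by
    intro v
    refine tendsto_const_nhds.congr' ?_
    by_cases hx : v < x
    · have : ∀ᶠ n in atTop, δ n < x - v := hδ0.eventually (gt_mem_nhds (sub_pos.2 hx))
      filter_upwards [this] with n hn
      rw [Set.indicator_of_mem (show x ∈ Set.Ioi v from hx), Pi.one_apply,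
        smoothTransition.one_of_one_le]
      rw [le_div_iff₀ (hδ n)]
      linarith
    · refine Eventually.of_forall fun n => ?_
      rw [Set.indicator_of_notMem (show x ∉ Set.Ioi v from hx)]
      refine (smoothTransition.zero_of_nonpos ?_).symm
      exact div_nonpos_of_nonpos_of_nonneg (by linarith [not_lt.1 hx]) (hδ n).le
  exact (((h u).const_mul a).const_sub 1).sub ((h u').const_mul b)

/-- Normal comparison lemma for products of step functions. -/
lemma abs_integral_prod_stepFun_sub_le {ι : Type*} [Fintype ι] {μ ν : Measure (ι → ℝ)}
    [IsGaussian μ] [IsGaussian ν]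
    (hμ : ∀ i, μ.map (fun x => x i) = gaussianReal 0 1)
    (hν : ∀ i, ν.map (fun x => x i) = gaussianReal 0 1)
    {a b : ι → ℝ} (ha : ∀ i, 0 ≤ a i) (hb : ∀ i, 0 ≤ b i) (hab : ∀ i, a i + b i ≤ 1)
    {u u' K : ℝ} (hu : 0 ≤ u) (huu : u ≤ u') (hK0 : 0 ≤ K)
    (hK : ∀ x, |deriv smoothTransition x| ≤ K * (Set.Icc (0 : ℝ) 1).indicator 1 x)
    {w : ι → ι → ℝ} (hw : ∀ i j, i ≠ j → w i j < 1)
    (hμw : ∀ i j, i ≠ j → |cov[fun x => x i, fun x => x j; μ]| ≤ w i j)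
    (hνw : ∀ i j, i ≠ j → |cov[fun x => x i, fun x => x j; ν]| ≤ w i j) :
    |∫ x, ∏ i, stepFun (a i) (b i) u u' (x i) ∂μ - ∫ x, ∏ i, stepFun (a i) (b i) u u' (x i) ∂ν| ≤
      (∑ i, ∑ j ∈ Finset.univ.erase i, |cov[fun x => x i, fun x => x j; μ] -
        cov[fun x => x i, fun x => x j; ν]| *
        (4 * K ^ 2 * ((√(1 - w i j ^ 2))⁻¹ * rexp (-(u ^ 2 / (1 + w i j)))))) * (π / 2) := by
  have hlim : ∀ (ρ : Measure (ι → ℝ)) [IsProbabilityMeasure ρ], Tendsto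
      (fun n : ℕ => ∫ x, ∏ i, smoothStepFun (a i) (b i) u u' (1 / ((n : ℝ) + 1)) (x i) ∂ρ) atTop
      (nhds (∫ x, ∏ i, stepFun (a i) (b i) u u' (x i) ∂ρ)) := by
    intro ρ _
    refine tendsto_integral_of_dominated_convergence (fun _ => 1) (fun n => ?_)
      (integrable_const _) (fun n => ae_of_all _ fun x => ?_) (ae_of_all _ fun x => ?_)
    · refine Measurable.aestronglyMeasurable (Finset.measurable_prod _ fun i _ => ?_)
      have : Continuous (smoothStepFun (a i) (b i) u u' (1 / ((n : ℝ) + 1))) :=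
        continuous_iff_continuousAt.2 fun x => (hasDerivAt_smoothStepFun _ _ _ _ _ x).continuousAt
      exact this.measurable.comp (measurable_pi_apply i)
    · rw [norm_eq_abs, Finset.abs_prod]
      exact Finset.prod_le_one (fun i _ => abs_nonneg _)
        fun i _ => abs_smoothStepFun_le (ha i) (hb i) (hab i) _ _ _ _
    · exact tendsto_finsetProd _ fun i _ => tendsto_smoothStepFun _ _ _ _ _
        (fun n => by positivity) tendsto_one_div_add_atTop_nhds_zero_nat
  refine le_of_tendsto ((hlim μ).sub (hlim ν)).abs (Eventually.of_forall fun n => ?_)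
  set δ : ℝ := 1 / ((n : ℝ) + 1) with hδdef
  have hδ : 0 < δ := by positivity
  set f : ι → ℝ → ℝ := fun i => smoothStepFun (a i) (b i) u u' δ with hf
  set f' : ι → ℝ → ℝ := fun i x => -(a i * (deriv smoothTransition ((x - u) / δ) / δ)) -
        b i * (deriv smoothTransition ((x - u') / δ) / δ) with hf'
  have hfc : ∀ i, Continuous (f i) := fun i =>
    continuous_iff_continuousAt.2 fun x => (hasDerivAt_smoothStepFun _ _ _ _ _ x).continuousAt
  have hfm : ∀ i, Measurable (f' i) := by
    intro i
    have hd : Measurable (deriv smoothTransition) := measurable_deriv _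
    have : ∀ v : ℝ, Measurable fun x => deriv smoothTransition ((x - v) / δ) / δ := fun v =>
      (hd.comp ((measurable_id.sub_const v).div_const δ)).div_const δ
    exact ((this u).const_mul _).neg.sub ((this u').const_mul _)
  have hf'b := fun i => abs_deriv_smoothStepFun_le (ha i) (hb i) (hab i) hδ hK u u'
  have hf'K : ∀ i x, |f' i x| ≤ K / δ * 2 := by
    intro i x
    refine (hf'b i x).trans (mul_le_mul_of_nonneg_left ?_ (by positivity))
    have : ∀ s : Set ℝ, s.indicator (1 : ℝ → ℝ) x ≤ 1 := fun s =>
      Set.indicator_le_self' (by simp) x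
    linarith [this (Set.Icc u (u + δ)), this (Set.Icc u' (u' + δ))]
  set P := μ.prod ν with hP
  have hX : Measurable (Prod.fst : (ι → ℝ) × (ι → ℝ) → ι → ℝ) := measurable_fst
  have hY : Measurable (Prod.snd : (ι → ℝ) × (ι → ℝ) → ι → ℝ) := measurable_snd
  have hXY : HasGaussianLaw (fun ω : (ι → ℝ) × (ι → ℝ) => (ω.1, ω.2)) P :=
    ⟨by simpa using (inferInstance : IsGaussian (μ.prod ν))⟩
  have hmX : P.map Prod.fst = μ := by simp [hP]
  have hmY : P.map Prod.snd = ν := by simp [hP]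
  have hX1 : ∀ i, P.map (fun ω => ω.1 i) = gaussianReal 0 1 := by
    intro i
    rw [← hμ i, ← hmX, Measure.map_map (by fun_prop) (by fun_prop)]; rfl
  have hY1 : ∀ i, P.map (fun ω => ω.2 i) = gaussianReal 0 1 := by
    intro i
    rw [← hν i, ← hmY, Measure.map_map (by fun_prop) (by fun_prop)]; rfl
  have hcX : ∀ i j, cov[fun ω => ω.1 i, fun ω => ω.1 j; P] =
      cov[fun x => x i, fun x => x j; μ] := by
    intro i j
    conv_rhs => rw [← hmX, covariance_map (measurable_pi_apply i).aestronglyMeasurable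
      (measurable_pi_apply j).aestronglyMeasurable (by fun_prop)]
    rfl
  have hcY : ∀ i j, cov[fun ω => ω.2 i, fun ω => ω.2 j; P] =
      cov[fun x => x i, fun x => x j; ν] := by
    intro i j
    conv_rhs => rw [← hmY, covariance_map (measurable_pi_apply i).aestronglyMeasurable
      (measurable_pi_apply j).aestronglyMeasurable (by fun_prop)]
    rfl
  have hc0 : ∀ i j, cov[fun ω => ω.1 i, fun ω => ω.2 j; P] = 0 := by
    intro i j
    refine IndepFun.covariance_eq_zero ?_ ?_ ?_
    · exact (indepFun_prod₀ (measurable_pi_apply i).aemeasurable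
        (measurable_pi_apply j).aemeasurable)
    · exact (hXY.fst.eval i).memLp_two
    · exact (hXY.snd.eval j).memLp_two
  have key := abs_integral_prod_sub_le hX hY hXY hX1 hY1 hc0 (f := f) (f' := f')
    (fun i x => hasDerivAt_smoothStepFun _ _ _ _ _ x)
    (fun i x => abs_smoothStepFun_le (ha i) (hb i) (hab i) _ _ _ _) hf'K hfm
    (M := fun i j => 4 * K ^ 2 * ((√(1 - w i j ^ 2))⁻¹ * rexp (-(u ^ 2 / (1 + w i j))))) ?_
  · simp only [hcX, hcY] at key
    have e1 : ∫ ω, ∏ i, f i (ω.1 i) ∂P = ∫ x, ∏ i, f i (x i) ∂μ := by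
      rw [← hmX, integral_map (by fun_prop)]
      exact (continuous_finsetProd _ fun i _ =>
        (hfc i).comp (continuous_apply i)).aestronglyMeasurable
    have e2 : ∫ ω, ∏ i, f i (ω.2 i) ∂P = ∫ x, ∏ i, f i (x i) ∂ν := by
      rw [← hmY, integral_map (by fun_prop)]
      exact (continuous_finsetProd _ fun i _ =>
        (hfc i).comp (continuous_apply i)).aestronglyMeasurable
    rwa [e1, e2] at key
  · intro i j hij θ
    have hXc : ∀ (c : ℝ) i, MemLp (fun ω : (ι → ℝ) × (ι → ℝ) => c * ω.1 i) 2 P := fun c i =>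
      (hXY.fst.eval i).memLp_two.const_mul c
    have hYc : ∀ (c : ℝ) i, MemLp (fun ω : (ι → ℝ) × (ι → ℝ) => c * ω.2 i) 2 P := fun c i =>
      (hXY.snd.eval i).memLp_two.const_mul c
    have hc0' : ∀ i j, cov[fun ω => ω.2 i, fun ω => ω.1 j; P] = 0 := by
      intro i j
      rw [covariance_comm]; exact hc0 j i
    set Z : ι → (ι → ℝ) × (ι → ℝ) → ℝ := fun i ω => sin θ * ω.1 i + cos θ * ω.2 i with hZ
    have hZm : ∀ i, Measurable (Z i) := fun i => by fun_prop
    have hcov : ∀ i j, cov[Z i, Z j; P] = sin θ ^ 2 * cov[fun x => x i, fun x => x j; μ] +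
        cos θ ^ 2 * cov[fun x => x i, fun x => x j; ν] := by
      intro i j
      have hZ2 : MemLp (fun ω : (ι → ℝ) × (ι → ℝ) => sin θ * ω.1 j + cos θ * ω.2 j) 2 P :=
        (hXc _ _).add (hYc _ _)
      simp only [hZ]
      erw [covariance_add_left (hXc _ _) (hYc _ _) hZ2,
        covariance_add_right (hXc _ _) (hXc _ _) (hYc _ _),
        covariance_add_right (hYc _ _) (hXc _ _) (hYc _ _)]
      simp only [covariance_const_mul_left, covariance_const_mul_right, hc0, hc0', hcX, hcY]
      ring
    have hvar : ∀ (ρ : Measure (ι → ℝ)) (i : ι), ρ.map (fun x => x i) = gaussianReal 0 1 →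
        cov[fun x => x i, fun x => x i; ρ] = 1 := by
      intro ρ i h
      have hv := variance_map (μ := ρ) (X := id) (Y := fun x : ι → ℝ => x i) aemeasurable_id
        (measurable_pi_apply i).aemeasurable
      rw [h, variance_id_gaussianReal] at hv
      rw [covariance_self (measurable_pi_apply i).aemeasurable]
      simpa using hv.symm
    have hZg : ∀ i j, HasGaussianLaw (fun ω => (Z i ω, Z j ω)) P := by
      intro i j
      let L : ι → (ι → ℝ) × (ι → ℝ) →L[ℝ] ℝ := fun i =>
        (sin θ • (ContinuousLinearMap.proj i).comp (ContinuousLinearMap.fst ℝ (ι → ℝ) (ι → ℝ))) +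
        (cos θ • (ContinuousLinearMap.proj i).comp (ContinuousLinearMap.snd ℝ (ι → ℝ) (ι → ℝ)))
      exact hXY.map_fun ((L i).prod (L j))
    have hZ1 : ∀ i, P.map (Z i) = gaussianReal 0 1 := by
      intro i
      rw [((hZg i i).fst : HasGaussianLaw (Z i) P).map_eq_gaussianReal]
      have v1 : Var[Z i; P] = 1 := by
        rw [← covariance_self (hZm i).aemeasurable, hcov, hvar μ i (hμ i), hvar ν i (hν i)]
        simp
      have m0 : P[Z i] = 0 := by
        have hmean : ∀ U : (ι → ℝ) × (ι → ℝ) → ℝ, Measurable U → P.map U = gaussianReal 0 1 →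
            P[U] = 0 := by
          intro U hU hl
          have h := integral_map (μ := P) (φ := U) hU.aemeasurable (f := fun x => x)
            (measurable_id.aestronglyMeasurable)
          rw [hl, integral_id_gaussianReal] at h
          exact h.symm
        simp only [hZ]
        rw [integral_add ((hXc _ _).integrable (by norm_num)) ((hYc _ _).integrable (by norm_num)),
          integral_const_mul, integral_const_mul, hmean _ (by fun_prop) (hX1 i),
          hmean _ (by fun_prop) (hY1 i)]
        simp
      rw [m0, v1]
      simp
    refine integral_abs_mul_abs_le_of_bivariate (hZm i) (hZm j) (hZg i j) (hZ1 i) (hZ1 j) ?_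
      (hw i j hij) hu huu hδ (hf'b i) (hf'b j)
    rw [hcov]
    have h1 := abs_le.1 (hμw i j hij)
    have h2 := abs_le.1 (hνw i j hij)
    have h3 := sin_sq_add_cos_sq θ
    rw [abs_le]
    constructor <;> nlinarith [mul_le_mul_of_nonneg_left h1.1 (sq_nonneg (sin θ)),
      mul_le_mul_of_nonneg_left h1.2 (sq_nonneg (sin θ)),
      mul_le_mul_of_nonneg_left h2.1 (sq_nonneg (cos θ)),
      mul_le_mul_of_nonneg_left h2.2 (sq_nonneg (cos θ))]

lemma tendsto_log_natCast_atTop : Tendsto (fun n : ℕ => log (n : ℝ)) atTop atTop :=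
  tendsto_log_atTop.comp tendsto_natCast_atTop_atTop

lemma tendsto_log_log_div_sqrt :
    Tendsto (fun n : ℕ => log (log n) / √(2 * log n)) atTop (nhds 0) := by
  have h1 : Tendsto (fun L : ℝ => log L / L ^ (1 / 2 : ℝ)) atTop (nhds 0) :=
    (isLittleO_log_rpow_atTop (by norm_num : (0 : ℝ) < 1 / 2)).tendsto_div_nhds_zero
  have h2 := (h1.comp tendsto_log_natCast_atTop).div_const (√2)
  rw [zero_div] at h2
  refine h2.congr fun n => ?_
  simp only [Function.comp, ← sqrt_eq_rpow]
  rw [sqrt_mul (by norm_num), div_div, mul_comm]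

/-- The deviation of `un n x` from its leading term. -/
noncomputable def unErr (n : ℕ) (x : ℝ) : ℝ :=
  (x - (log (log n) + log (4 * π)) / 2) / √(2 * log n)

lemma un_eq_add_unErr (n : ℕ) (x : ℝ) : un n x = √(2 * log n) + unErr n x := by
  unfold un unErr
  ring

lemma tendsto_sqrt_two_mul_log : Tendsto (fun n : ℕ => √(2 * log (n : ℝ))) atTop atTop :=
  tendsto_sqrt_atTop.comp (tendsto_log_natCast_atTop.const_mul_atTop (by norm_num))

lemma tendsto_unErr (x : ℝ) : Tendsto (fun n => unErr n x) atTop (nhds 0) := by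
  have h : Tendsto (fun n : ℕ => (x - log (4 * π) / 2) / √(2 * log (n : ℝ)) -
      (log (log n) / √(2 * log n)) / 2) atTop (nhds (0 - 0 / 2)) :=
    (tendsto_sqrt_two_mul_log.const_div_atTop _).sub (tendsto_log_log_div_sqrt.div_const 2)
  rw [zero_div, sub_zero] at h
  refine h.congr fun n => ?_
  unfold unErr
  ring

lemma un_sq {n : ℕ} (hn : 2 ≤ n) (x : ℝ) :
    un n x ^ 2 = 2 * log n + 2 * x - (log (log n) + log (4 * π)) + unErr n x ^ 2 := by
  have hL : 0 < log (n : ℝ) := log_pos (by exact_mod_cast hn)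
  rw [un_eq_add_unErr, add_sq, sq_sqrt (by positivity)]
  have : 2 * √(2 * log n) * unErr n x = 2 * x - (log (log n) + log (4 * π)) := by
    unfold unErr
    have : √(2 * log n) ≠ 0 := (sqrt_pos.2 (by positivity)).ne'
    field_simp
  rw [this]
  ring

lemma tendsto_un_atTop (x : ℝ) : Tendsto (fun n => un n x) atTop atTop := by
  simp only [un_eq_add_unErr]
  exact tendsto_sqrt_two_mul_log.atTop_add (tendsto_unErr x)

lemma un_mono {n : ℕ} {x y : ℝ} (h : x ≤ y) : un n x ≤ un n y := by
  unfold un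
  gcongr

lemma eventually_un_sq_le (x : ℝ) : ∀ᶠ n : ℕ in atTop, un n x ^ 2 ≤ 8 * log n := by
  filter_upwards [(tendsto_un_atTop x).eventually_ge_atTop 0,
    (tendsto_unErr x).eventually (gt_mem_nhds one_pos),
    tendsto_sqrt_two_mul_log.eventually_ge_atTop 1,
    tendsto_log_natCast_atTop.eventually_ge_atTop 0] with n h0 h1 h2 h3
  have : un n x ≤ 2 * √(2 * log n) := by rw [un_eq_add_unErr]; linarith
  calc un n x ^ 2 ≤ (2 * √(2 * log n)) ^ 2 := pow_le_pow_left₀ h0 this 2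
    _ = 8 * log n := by rw [mul_pow, sq_sqrt (by positivity)]; ring

lemma exp_neg_un_sq_le {n : ℕ} (hn : 2 ≤ n) (x : ℝ) :
    rexp (-un n x ^ 2) ≤ 4 * π * rexp (-2 * x) * (log n / n ^ 2) := by
  have hn0 : (0 : ℝ) < n := by positivity
  have hL : 0 < log (n : ℝ) := log_pos (by exact_mod_cast hn)
  have : 4 * π * rexp (-2 * x) * (log n / n ^ 2) =
      rexp (-2 * log n - 2 * x + (log (log n) + log (4 * π))) := by
    rw [exp_add, exp_sub, exp_add, exp_log hL, exp_log (by positivity),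
      show -2 * log (n : ℝ) = -(log n + log n) by ring, exp_neg, exp_add, exp_log hn0,
      show -2 * x = -(2 * x) by ring, exp_neg]
    field_simp
  rw [this, exp_le_exp, un_sq hn]
  nlinarith [sq_nonneg (unErr n x)]

lemma sum_Icc_one_eq_sum_range {M : Type*} [AddCommMonoid M] (f : ℕ → M) (n : ℕ) :
    ∑ k ∈ Finset.Icc 1 n, f k = ∑ i ∈ Finset.range n, f (i + 1) := by
  induction n with
  | zero => simp
  | succ n ih => rw [Finset.sum_Icc_succ_top (by omega), ih, Finset.sum_range_succ]

lemma sum_log_div_le (n : ℕ) : ∑ k ∈ Finset.Icc 1 n, log ((n : ℝ) / k) ≤ n := by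
  rcases Nat.eq_zero_or_pos n with rfl | hn
  · simp
  have hn0 : (0 : ℝ) < n := by exact_mod_cast hn
  have h1 : ∑ k ∈ Finset.Icc 1 n, log ((n : ℝ) / k) = log ((n : ℝ) ^ n / n.factorial) := by
    rw [sum_Icc_one_eq_sum_range (fun k : ℕ => log ((n : ℝ) / k)), ← log_prod,
      Finset.prod_div_distrib, Finset.prod_const, Finset.card_range,
      ← Finset.prod_range_add_one_eq_factorial, Nat.cast_prod]
    intro k _
    positivity
  rw [h1, log_le_iff_le_exp (by positivity)]
  exact pow_div_factorial_le_exp (n : ℝ) hn0.le n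

/-- The sum in the normal comparison inequality is negligible at the levels `un n x`. -/
lemma tendsto_berman_sum {r : ℕ → ℝ} {γ δ : ℝ} (hγ : 0 ≤ γ) (hδ0 : 0 < δ) (hδ : δ < 1)
    (hrδ : ∀ k, 1 ≤ k → |r k| ≤ δ) (hr : Tendsto (fun n : ℕ => r n * log n) atTop (nhds γ))
    (x : ℝ) :
    Tendsto (fun n : ℕ => (n : ℝ) * ∑ k ∈ Finset.Icc 1 n, |r k - γ / log n| *
      ((√(1 - max |r k| (γ / log n) ^ 2))⁻¹ *
        rexp (-(un n x ^ 2 / (1 + max |r k| (γ / log n)))))) atTop (nhds 0) := by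
  obtain ⟨C, hC⟩ : ∃ C, ∀ k : ℕ, |r k * log k| ≤ C := by
    obtain ⟨C, hC⟩ := hr.norm.bddAbove_range
    exact ⟨C, fun k => hC ⟨k, rfl⟩⟩
  have hC0 : 0 ≤ C := (abs_nonneg _).trans (hC 0)
  set α : ℝ := (1 - δ) / (2 * (1 + δ)) with hα
  have hα0 : 0 < α := div_pos (by linarith) (by linarith)
  set C' : ℝ := max (C / α) γ with hC'
  have hC'0 : 0 ≤ C' := hγ.trans (le_max_right _ _)
  set B : ℝ := (√(1 - δ ^ 2))⁻¹ with hB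
  have hB0 : 0 ≤ B := by positivity
  set D : ℝ := 4 * π * rexp (-2 * x) with hD
  have hD0 : 0 ≤ D := by positivity
  set m1 : ℕ → ℝ := fun n => 2 * B * ((n : ℝ) ^ (1 + α) * (D * (log n / n ^ 2)) ^ (1 / (1 + δ)))
    with hm1
  set m2 : ℕ → ℝ := fun n => B * D * rexp (8 * C') *
    ((∑ k ∈ Finset.Icc 1 n, |r k * log k - γ|) / n + C' / log n) with hm2
  have hm1lim : Tendsto m1 atTop (nhds 0) := by
    have h1 : Tendsto (fun t : ℝ => log t ^ (1 / (1 + δ)) / t ^ α) atTop (nhds 0) :=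
      (isLittleO_log_rpow_rpow_atTop _ hα0).tendsto_div_nhds_zero
    have h2 := (h1.comp (tendsto_natCast_atTop_atTop (R := ℝ))).const_mul
      (2 * B * D ^ (1 / (1 + δ)))
    rw [mul_zero] at h2
    refine h2.congr' ?_
    filter_upwards [eventually_ge_atTop 2] with n hn
    have hn0 : (0 : ℝ) < n := by positivity
    have hL : 0 < log (n : ℝ) := log_pos (by exact_mod_cast hn)
    simp only [Function.comp, hm1]
    rw [mul_rpow hD0 (by positivity), div_rpow hL.le (by positivity), ← rpow_natCast,
      ← rpow_mul hn0.le]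
    have e : (n : ℝ) ^ (1 + α) = n ^ (((2 : ℕ) : ℝ) * (1 / (1 + δ))) * ((n : ℝ) ^ α)⁻¹ := by
      rw [← rpow_neg hn0.le, ← rpow_add hn0]
      congr 1
      have : 1 + δ ≠ 0 := by linarith
      rw [hα]
      field_simp
      push_cast
      ring
    rw [e]
    have : (n : ℝ) ^ (((2 : ℕ) : ℝ) * (1 / (1 + δ))) ≠ 0 := by positivity
    field_simp
  have hm2lim : Tendsto m2 atTop (nhds 0) := by
    have h1 : Tendsto (fun k : ℕ => |r (k + 1) * log ((k + 1 : ℕ) : ℝ) - γ|) atTop (nhds 0) := by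
      have := ((hr.comp (tendsto_add_atTop_nat 1)).sub_const γ).abs
      simpa using this
    have h2 := h1.cesaro.add (tendsto_log_natCast_atTop.const_div_atTop C')
    have h3 := h2.const_mul (B * D * rexp (8 * C'))
    rw [add_zero, mul_zero] at h3
    refine h3.congr fun n => ?_
    simp only [hm2]
    rw [sum_Icc_one_eq_sum_range (fun k : ℕ => |r k * log k - γ|), inv_mul_eq_div (n : ℝ)]
  have hlim : Tendsto (fun n => m1 n + m2 n) atTop (nhds 0) := by
    simpa using hm1lim.add hm2lim
  refine squeeze_zero' (Eventually.of_forall fun n => by positivity) ?_ hlim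
  have hρ : Tendsto (fun n : ℕ => γ / log (n : ℝ)) atTop (nhds 0) :=
    tendsto_log_natCast_atTop.const_div_atTop γ
  filter_upwards [eventually_ge_atTop 2, eventually_un_sq_le x,
    hρ.eventually (gt_mem_nhds hδ0)] with n hn hun hρn
  have hn0 : (0 : ℝ) < n := by positivity
  have hL : 0 < log (n : ℝ) := log_pos (by exact_mod_cast hn)
  set ρ := γ / log (n : ℝ) with hρdef
  have hρ0 : 0 ≤ ρ := by positivity
  have hterm : ∀ k ∈ Finset.Icc 1 n, |r k - ρ| * ((√(1 - max |r k| ρ ^ 2))⁻¹ *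
        rexp (-(un n x ^ 2 / (1 + max |r k| ρ)))) ≤
      (if (k : ℝ) ≤ n ^ α then 2 * B * (D * (log n / n ^ 2)) ^ (1 / (1 + δ)) else 0) +
      B * D * rexp (8 * C') * ((|r k * log k - γ| + C' / log n * log ((n : ℝ) / k)) / n ^ 2) := by
    intro k hk
    obtain ⟨hk1, hkn⟩ := Finset.mem_Icc.1 hk
    have hk0 : (0 : ℝ) < k := by exact_mod_cast hk1
    have hkn' : (1 : ℝ) ≤ n / k := by rw [le_div_iff₀ hk0, one_mul]; exact_mod_cast hkn
    set w := max |r k| ρ with hw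
    have hw0 : 0 ≤ w := hρ0.trans (le_max_right _ _)
    have hwδ : w ≤ δ := max_le (hrδ k hk1) hρn.le
    have hsq : (√(1 - w ^ 2))⁻¹ ≤ B := by
      refine inv_anti₀ (sqrt_pos.2 (by nlinarith)) (sqrt_le_sqrt ?_)
      nlinarith
    have hlast : 0 ≤ B * D * rexp (8 * C') *
        ((|r k * log k - γ| + C' / log n * log ((n : ℝ) / k)) / n ^ 2) := by
      have := log_nonneg hkn'
      positivity
    by_cases hkα : (k : ℝ) ≤ n ^ α
    · rw [if_pos hkα]
      refine le_add_of_le_of_nonneg ?_ hlast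
      have h2 : |r k - ρ| ≤ 2 := by
        have := abs_sub (r k) ρ
        rw [abs_of_nonneg hρ0] at this
        linarith [hrδ k hk1]
      have he : rexp (-(un n x ^ 2 / (1 + w))) ≤ (D * (log n / n ^ 2)) ^ (1 / (1 + δ)) := by
        refine le_trans ?_ (rpow_le_rpow (exp_pos _).le (exp_neg_un_sq_le hn x) (by positivity))
        rw [← exp_mul, exp_le_exp, mul_one_div, neg_div]
        exact neg_le_neg (div_le_div_of_nonneg_left (sq_nonneg _) (by linarith) (by linarith))
      calc _ ≤ 2 * (B * (D * (log n / n ^ 2)) ^ (1 / (1 + δ))) := by gcongr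
        _ = _ := by ring
    · rw [if_neg hkα, zero_add]
      have hlogk : α * log n < log k := by
        rw [← log_rpow hn0]
        exact log_lt_log (by positivity) (not_le.1 hkα)
      have hlogk0 : 0 < log (k : ℝ) := lt_trans (by positivity) hlogk
      have hrk : |r k| ≤ C' / log n := by
        have h1 : |r k| * log k ≤ C := by
          have := hC k
          rwa [abs_mul, abs_of_pos hlogk0] at this
        have h2 : |r k| * (α * log n) ≤ C :=
          (mul_le_mul_of_nonneg_left hlogk.le (abs_nonneg _)).trans h1
        rw [le_div_iff₀ hL]
        refine le_trans ?_ (le_max_left _ _)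
        rw [le_div_iff₀ hα0]
        linarith
      have hwC : w ≤ C' / log n :=
        max_le hrk (div_le_div_of_nonneg_right (le_max_right _ _) hL.le)
      have he : rexp (-(un n x ^ 2 / (1 + w))) ≤ D * (log n / n ^ 2) * rexp (8 * C') := by
        refine le_trans ?_ (mul_le_mul_of_nonneg_right (exp_neg_un_sq_le hn x) (exp_pos _).le)
        rw [← exp_add, exp_le_exp]
        have h1 : un n x ^ 2 * w ≤ 8 * C' := by
          calc un n x ^ 2 * w ≤ (8 * log n) * (C' / log n) := by gcongr
            _ = 8 * C' := by field_simp
        have h2 : un n x ^ 2 * (1 - w) ≤ un n x ^ 2 / (1 + w) := by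
          rw [le_div_iff₀ (by linarith)]
          nlinarith [mul_nonneg (sq_nonneg (un n x)) (sq_nonneg w)]
        linarith
      have hd : log n * |r k - ρ| ≤ |r k * log k - γ| + C' / log n * log ((n : ℝ) / k) := by
        have e1 : log n * |r k - ρ| = |(r k * log k - γ) + r k * log ((n : ℝ) / k)| := by
          rw [show log (n : ℝ) * |r k - ρ| = |log (n : ℝ) * (r k - ρ)| by
            rw [abs_mul, abs_of_pos hL], log_div hn0.ne' hk0.ne', hρdef]
          congr 1
          field_simp
          ring
        rw [e1]
        refine (abs_add_le _ _).trans ?_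
        rw [abs_mul, abs_of_nonneg (log_nonneg hkn')]
        gcongr
        exact log_nonneg hkn'
      calc _ ≤ |r k - ρ| * (B * (D * (log n / n ^ 2) * rexp (8 * C'))) := by gcongr
        _ = B * D * rexp (8 * C') * ((log n * |r k - ρ|) / n ^ 2) := by ring
        _ ≤ _ := by gcongr
  have hcard : ∑ k ∈ Finset.Icc 1 n,
      (if (k : ℝ) ≤ n ^ α then 2 * B * (D * (log n / n ^ 2)) ^ (1 / (1 + δ)) else 0) ≤
      n ^ α * (2 * B * (D * (log n / n ^ 2)) ^ (1 / (1 + δ))) := by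
    rw [← Finset.sum_filter, Finset.sum_const, nsmul_eq_mul]
    refine mul_le_mul_of_nonneg_right ?_ (by positivity)
    have hsub : (Finset.Icc 1 n).filter (fun k : ℕ => (k : ℝ) ≤ n ^ α) ⊆
        Finset.Icc 1 ⌊(n : ℝ) ^ α⌋₊ := by
      intro k hk
      rw [Finset.mem_filter, Finset.mem_Icc] at hk
      exact Finset.mem_Icc.2 ⟨hk.1.1, Nat.le_floor hk.2⟩
    have := Finset.card_le_card hsub
    rw [Nat.card_Icc, Nat.add_sub_cancel] at this
    exact (Nat.cast_le.2 this).trans (Nat.floor_le (by positivity))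
  calc _ ≤ n * ((n ^ α * (2 * B * (D * (log n / n ^ 2)) ^ (1 / (1 + δ)))) +
        B * D * rexp (8 * C') * ((∑ k ∈ Finset.Icc 1 n, |r k * log k - γ| +
          C' / log n * n) / n ^ 2)) := by
        refine mul_le_mul_of_nonneg_left ((Finset.sum_le_sum hterm).trans ?_) hn0.le
        rw [Finset.sum_add_distrib, ← Finset.mul_sum, ← Finset.sum_div, Finset.sum_add_distrib,
          ← Finset.mul_sum]
        gcongr
        exact sum_log_div_le n
    _ = m1 n + m2 n := by
        simp only [hm1, hm2]
        rw [rpow_add hn0, rpow_one]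
        field_simp

/-- The tail of the standard normal law. -/
noncomputable def gaussTail (v : ℝ) : ℝ := (gaussianReal 0 1).real (Set.Ioi v)

lemma gaussTail_nonneg (v : ℝ) : 0 ≤ gaussTail v := measureReal_nonneg

lemma gaussTail_le_one (v : ℝ) : gaussTail v ≤ 1 := measureReal_le_one

lemma gaussTail_anti : Antitone gaussTail := fun _ _ h =>
  measureReal_mono (Set.Ioi_subset_Ioi h)

lemma gaussTail_eq_integral (v : ℝ) : gaussTail v = ∫ t in Set.Ioi v, gaussianPDFReal 0 1 t := by
  rw [gaussTail, Measure.real, gaussianReal_apply_eq_integral 0 one_ne_zero,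
    ENNReal.toReal_ofReal (integral_nonneg fun _ => gaussianPDFReal_nonneg _ _ _)]

/-- Two-sided Mills ratio bound. -/
lemma gaussTail_bounds {v : ℝ} (hv : 0 < v) :
    gaussTail v ≤ gaussianPDFReal 0 1 v / v ∧
      gaussianPDFReal 0 1 v / v ≤ (1 + 1 / v ^ 2) * gaussTail v := by
  have hderiv : ∀ t ∈ Set.Ici v, HasDerivAt (fun t => -(gaussianPDFReal 0 1 t / t))
      (gaussianPDFReal 0 1 t * (1 + 1 / t ^ 2)) t := by
    intro t ht
    have ht0 : t ≠ 0 := (hv.trans_le ht).ne'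
    refine ((hasDerivAt_gaussianPDFReal_std t).fun_div (hasDerivAt_id t) ht0).fun_neg.congr_deriv ?_
    simp only [id]
    field_simp
    ring
  have hpos : ∀ t ∈ Set.Ioi v, 0 ≤ gaussianPDFReal 0 1 t * (1 + 1 / t ^ 2) := fun t _ =>
    mul_nonneg (gaussianPDFReal_nonneg _ _ _) (by positivity)
  have hlim : Tendsto (fun t : ℝ => -(gaussianPDFReal 0 1 t / t)) atTop (nhds 0) := by
    rw [show nhds (0 : ℝ) = nhds (-0) by rw [neg_zero]]
    refine Tendsto.neg (squeeze_zero' ?_ ?_ (tendsto_const_nhds.div_atTop tendsto_id :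
      Tendsto (fun t : ℝ => (√(2 * π))⁻¹ / t) atTop (nhds 0)))
    · filter_upwards [eventually_gt_atTop 0] with t ht
      exact div_nonneg (gaussianPDFReal_nonneg _ _ _) ht.le
    · filter_upwards [eventually_gt_atTop 0] with t ht
      refine div_le_div_of_nonneg_right ?_ ht.le
      rw [gaussianPDFReal_std]
      exact mul_le_of_le_one_right (by positivity) (exp_le_one_iff.2 (by nlinarith [sq_nonneg t]))
  have hval := integral_Ioi_of_hasDerivAt_of_nonneg' hderiv hpos hlim
  have hint := integrableOn_Ioi_deriv_of_nonneg' hderiv hpos hlim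
  have hφ : IntegrableOn (gaussianPDFReal 0 1) (Set.Ioi v) :=
    (integrable_gaussianPDFReal 0 1).integrableOn
  rw [zero_sub, neg_neg] at hval
  rw [← hval, gaussTail_eq_integral, ← integral_const_mul]
  constructor
  · refine setIntegral_mono_on hφ hint measurableSet_Ioi fun t _ => ?_
    exact le_mul_of_one_le_right (gaussianPDFReal_nonneg _ _ _) (by
      have : 0 ≤ 1 / t ^ 2 := by positivity
      linarith)
  · refine setIntegral_mono_on hint (hφ.const_mul _) measurableSet_Ioi fun t ht => ?_
    have ht' : v ≤ t := le_of_lt ht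
    rw [mul_comm]
    refine mul_le_mul_of_nonneg_right ?_ (gaussianPDFReal_nonneg _ _ _)
    gcongr

lemma tendsto_mul_gaussTail {v : ℕ → ℝ} {L : ℝ} (hv : Tendsto v atTop atTop)
    (h : Tendsto (fun n : ℕ => (n : ℝ) * (gaussianPDFReal 0 1 (v n) / v n)) atTop (nhds L)) :
    Tendsto (fun n : ℕ => (n : ℝ) * gaussTail (v n)) atTop (nhds L) := by
  have h1 : Tendsto (fun n => 1 + 1 / v n ^ 2) atTop (nhds 1) := by
    have : Tendsto (fun n => 1 / v n ^ 2) atTop (nhds 0) :=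
      ((tendsto_pow_atTop two_ne_zero).comp hv).const_div_atTop 1
    simpa using this.const_add 1
  have h2 : Tendsto
      (fun n : ℕ => (n : ℝ) * (gaussianPDFReal 0 1 (v n) / v n) / (1 + 1 / v n ^ 2)) atTop
      (nhds L) := by
    have := h.div h1 one_ne_zero
    rwa [div_one] at this
  refine tendsto_of_tendsto_of_tendsto_of_le_of_le' h2 h ?_ ?_
  · filter_upwards [hv.eventually_gt_atTop 0] with n hn
    rw [div_le_iff₀ (by positivity), mul_assoc, mul_comm (gaussTail _)]
    exact mul_le_mul_of_nonneg_left (gaussTail_bounds hn).2 (Nat.cast_nonneg n)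
  · filter_upwards [hv.eventually_gt_atTop 0] with n hn
    exact mul_le_mul_of_nonneg_left (gaussTail_bounds hn).1 (Nat.cast_nonneg n)

/-- The level seen by the idiosyncratic part, given the common factor `z`. -/
noncomputable def condLevel (γ : ℝ) (n : ℕ) (x z : ℝ) : ℝ :=
  (un n x - √(γ / log n) * z) / √(1 - γ / log n)

lemma tendsto_mul_gaussTail_condLevel {γ : ℝ} (hγ : 0 ≤ γ) (x z : ℝ) :
    Tendsto (fun n : ℕ => (n : ℝ) * gaussTail (condLevel γ n x z)) atTop (nhds (g γ x z)) := by
  have hρ : Tendsto (fun n : ℕ => γ / log (n : ℝ)) atTop (nhds 0) :=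
    tendsto_log_natCast_atTop.const_div_atTop γ
  have hsρ : Tendsto (fun n : ℕ => √(γ / log (n : ℝ))) atTop (nhds 0) := by
    simpa [Function.comp_def] using (continuous_sqrt.tendsto 0).comp hρ
  have h1ρ : Tendsto (fun n : ℕ => 1 - γ / log (n : ℝ)) atTop (nhds 1) := by
    simpa using hρ.const_sub 1
  have hs1ρ : Tendsto (fun n : ℕ => √(1 - γ / log (n : ℝ))) atTop (nhds 1) := by
    simpa [Function.comp_def] using (continuous_sqrt.tendsto 1).comp h1ρ
  have hinv : Tendsto (fun n : ℕ => (√(2 * log (n : ℝ)))⁻¹) atTop (nhds 0) :=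
    tendsto_inv_atTop_zero.comp tendsto_sqrt_two_mul_log
  have hratio : Tendsto (fun n => condLevel γ n x z / √(2 * log n)) atTop (nhds 1) := by
    have h := ((((tendsto_unErr x).mul hinv).const_add 1).sub ((hsρ.mul_const z).mul hinv)).div
      hs1ρ one_ne_zero
    simp only [mul_zero, add_zero, sub_zero, div_one] at h
    refine h.congr' ?_
    filter_upwards [tendsto_sqrt_two_mul_log.eventually_gt_atTop 0] with n hn
    simp only [condLevel, un_eq_add_unErr, Pi.div_apply]
    field_simp
  have hv : Tendsto (fun n => condLevel γ n x z) atTop atTop := by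
    have h := hratio.pos_mul_atTop one_pos tendsto_sqrt_two_mul_log
    refine h.congr' ?_
    filter_upwards [tendsto_sqrt_two_mul_log.eventually_gt_atTop 0] with n hn
    field_simp
  refine tendsto_mul_gaussTail hv ?_
  set c : ℕ → ℝ := fun n => log (log n) + log (4 * π) with hc
  have hρc : Tendsto (fun n : ℕ => γ / log (n : ℝ) * c n) atTop (nhds 0) := by
    have h1 := (tendsto_log_log_div_sqrt.mul hinv).const_mul (2 * γ)
    have h2 := (h1.add (hρ.mul_const (log (4 * π))))
    simp only [mul_zero, zero_mul, add_zero] at h2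
    refine h2.congr' ?_
    filter_upwards [tendsto_log_natCast_atTop.eventually_gt_atTop 0] with n hn
    have hs : √(2 * log (n : ℝ)) * √(2 * log n) = 2 * log n := mul_self_sqrt (by positivity)
    have hs0 : 0 < √(2 * log (n : ℝ)) := sqrt_pos.2 (by positivity)
    simp only [hc]
    rw [← div_eq_mul_inv, div_div, hs]
    field_simp
  have huρ : Tendsto (fun n : ℕ => un n x * √(γ / log (n : ℝ))) atTop (nhds (√(2 * γ))) := by
    have h := ((tendsto_unErr x).mul hsρ).const_add (√(2 * γ))
    simp only [mul_zero, add_zero] at h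
    refine h.congr' ?_
    filter_upwards [tendsto_log_natCast_atTop.eventually_gt_atTop 0] with n hn
    have : 2 * log (n : ℝ) * (γ / log n) = 2 * γ := by field_simp
    rw [un_eq_add_unErr, add_mul, ← sqrt_mul (by positivity), this]
  have hE : Tendsto (fun n : ℕ => (-γ + γ / log (n : ℝ) * c n / 2 - x - unErr n x ^ 2 / 2 +
      un n x * √(γ / log (n : ℝ)) * z - γ / log (n : ℝ) * z ^ 2 / 2) / (1 - γ / log (n : ℝ))) atTop
      (nhds (-x - γ + √(2 * γ) * z)) := by
    have h := ((((((hρc.div_const 2).const_add (-γ)).sub_const x).sub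
      (((tendsto_unErr x).pow 2).div_const 2)).add (huρ.mul_const z)).sub
      ((hρ.mul_const (z ^ 2)).div_const 2)).div h1ρ one_ne_zero
    convert! h using 2
    simp
    ring
  have hfin := ((continuous_exp.tendsto _).comp hE).mul (hratio.inv₀ one_ne_zero)
  rw [inv_one, mul_one] at hfin
  refine hfin.congr' ?_
  filter_upwards [tendsto_log_natCast_atTop.eventually_gt_atTop 0, eventually_ge_atTop 2,
    h1ρ.eventually (lt_mem_nhds one_pos)] with n hL hn hρn
  have hn0 : (0 : ℝ) < n := by positivity
  set L := log (n : ℝ) with hLdef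
  have hvsq : condLevel γ n x z ^ 2 * (1 - γ / L) =
      (2 * L + 2 * x - c n + unErr n x ^ 2) - 2 * (un n x * √(γ / L) * z) + γ / L * z ^ 2 := by
    rw [condLevel, div_pow, sq_sqrt hρn.le, div_mul_cancel₀ _ hρn.ne', sub_sq, mul_pow,
      sq_sqrt (by positivity), un_sq hn]
    ring
  have hexp : (-γ + γ / L * c n / 2 - x - unErr n x ^ 2 / 2 +
      un n x * √(γ / L) * z - γ / L * z ^ 2 / 2) / (1 - γ / L) =
      L + -condLevel γ n x z ^ 2 / 2 - c n / 2 := by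
    rw [div_eq_iff hρn.ne']
    have hLγ : γ / L * L = γ := by field_simp
    linear_combination (1 / 2 : ℝ) * hvsq + hLγ
  have hc2 : rexp (c n / 2) = √(4 * π * L) := by
    rw [exp_half, exp_add, exp_log hL, exp_log (by positivity), mul_comm]
  simp only [Function.comp]
  rw [hexp, exp_sub, exp_add, exp_log hn0, hc2, gaussianPDFReal_std,
    show 4 * π * L = 2 * π * (2 * L) by ring, sqrt_mul (by positivity)]
  have h1 : √(2 * π) ≠ 0 := by positivity
  have h2 : √(2 * L) ≠ 0 := by positivity
  field_simp

instance isGaussian_pi_gaussianReal (ι : Type*) [Fintype ι] :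
    IsGaussian (Measure.pi fun _ : ι => gaussianReal 0 1) := by
  have hind : iIndepFun (fun i (x : ι → ℝ) => x i) (Measure.pi fun _ : ι => gaussianReal 0 1) :=
    iIndepFun_pi (X := fun _ x => x) (fun _ => aemeasurable_id)
  have hg : ∀ i, HasGaussianLaw (fun x : ι → ℝ => x i)
      (Measure.pi fun _ : ι => gaussianReal 0 1) := by
    intro i
    have : (Measure.pi fun _ : ι => gaussianReal 0 1).map (fun x => x i) = gaussianReal 0 1 :=
      (measurePreserving_eval (fun _ : ι => gaussianReal 0 1) i).map_eq
    exact ⟨by rw [this]; infer_instance⟩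
  have := (hind.hasGaussianLaw hg).isGaussian_map
  rwa [show (fun (x : ι → ℝ) i => x i) = id from rfl, Measure.map_id] at this

/-- The linear map sending a common factor and idiosyncratic noise to an equicorrelated vector. -/
noncomputable def equicorrMap (ι : Type*) [Fintype ι] (c d : ℝ) : ℝ × (ι → ℝ) →L[ℝ] (ι → ℝ) :=
  ContinuousLinearMap.pi fun i =>
    c • ContinuousLinearMap.fst ℝ ℝ (ι → ℝ) +
      d • (ContinuousLinearMap.proj i).comp (ContinuousLinearMap.snd ℝ ℝ (ι → ℝ))

lemma equicorrMap_apply {ι : Type*} [Fintype ι] (c d : ℝ) (p : ℝ × (ι → ℝ)) (i : ι) :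
    equicorrMap ι c d p i = c * p.1 + d * p.2 i := by
  simp [equicorrMap]

/-- The standard Gaussian vector with all correlations equal to `ρ`. -/
noncomputable def equicorr (ι : Type*) [Fintype ι] (ρ : ℝ) : Measure (ι → ℝ) :=
  ((gaussianReal 0 1).prod (Measure.pi fun _ : ι => gaussianReal 0 1)).map
    (equicorrMap ι (√ρ) (√(1 - ρ)))

instance isGaussian_equicorr (ι : Type*) [Fintype ι] (ρ : ℝ) : IsGaussian (equicorr ι ρ) := by
  unfold equicorr; infer_instance

section
variable {ι : Type*} [Fintype ι]

lemma covariance_pi_gaussianReal (i j : ι) :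
    cov[fun x => x i, fun x => x j; Measure.pi fun _ : ι => gaussianReal 0 1] =
      if i = j then 1 else 0 := by
  set Q := Measure.pi fun _ : ι => gaussianReal 0 1
  have hmap : ∀ i, Q.map (fun x => x i) = gaussianReal 0 1 := fun i =>
    (measurePreserving_eval (fun _ : ι => gaussianReal 0 1) i).map_eq
  have hg : HasGaussianLaw (fun x : ι → ℝ => x) Q :=
    ⟨by rw [show (fun x : ι → ℝ => x) = id from rfl, Measure.map_id]; infer_instance⟩
  split_ifs with h
  · subst h
    have hv := variance_map (μ := Q) (X := id) (Y := fun x : ι → ℝ => x i) aemeasurable_id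
      (measurable_pi_apply i).aemeasurable
    rw [hmap, variance_id_gaussianReal] at hv
    rw [covariance_self (measurable_pi_apply i).aemeasurable]
    simpa using hv.symm
  · have hind : iIndepFun (fun i (x : ι → ℝ) => x i) Q :=
      iIndepFun_pi (X := fun _ x => x) (fun _ => aemeasurable_id)
    exact (hind.indepFun h).covariance_eq_zero (hg.eval i).memLp_two (hg.eval j).memLp_two

lemma covariance_equicorr {ρ : ℝ} (h0 : 0 ≤ ρ) (h1 : ρ ≤ 1) (i j : ι) :
    cov[fun x => x i, fun x => x j; equicorr ι ρ] = if i = j then 1 else ρ := by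
  set Q := Measure.pi fun _ : ι => gaussianReal 0 1 with hQ
  set P := (gaussianReal 0 1).prod Q with hP
  have hXY : HasGaussianLaw (fun ω : ℝ × (ι → ℝ) => (ω.1, ω.2)) P :=
    ⟨by simpa using (inferInstance : IsGaussian ((gaussianReal 0 1).prod Q))⟩
  have hX2 : MemLp (fun ω : ℝ × (ι → ℝ) => ω.1) 2 P := hXY.fst.memLp_two
  have hY2 : ∀ i, MemLp (fun ω : ℝ × (ι → ℝ) => ω.2 i) 2 P := fun i =>
    (hXY.snd.eval i).memLp_two
  have hmX : P.map Prod.fst = gaussianReal 0 1 := by simp [hP]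
  have hmY : P.map Prod.snd = Q := by simp [hP]
  have hcX : cov[fun ω => ω.1, fun ω => ω.1; P] = 1 := by
    have hv := variance_map (μ := P) (X := id) (Y := Prod.fst) aemeasurable_id
      measurable_fst.aemeasurable
    rw [hmX, variance_id_gaussianReal] at hv
    rw [covariance_self measurable_fst.aemeasurable]
    simpa using hv.symm
  have hcY : ∀ i j, cov[fun ω => ω.2 i, fun ω => ω.2 j; P] = if i = j then 1 else 0 := by
    intro i j
    rw [← covariance_pi_gaussianReal i j, ← hQ, ← hmY,
      covariance_map (measurable_pi_apply i).aestronglyMeasurable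
      (measurable_pi_apply j).aestronglyMeasurable (by fun_prop)]
    rfl
  have hc0 : ∀ j, cov[fun ω => ω.1, fun ω => ω.2 j; P] = 0 := fun j =>
    (indepFun_prod₀ aemeasurable_id (measurable_pi_apply j).aemeasurable).covariance_eq_zero
      hX2 (hY2 j)
  have hc0' : ∀ j, cov[fun ω => ω.2 j, fun ω => ω.1; P] = 0 := fun j => by
    rw [covariance_comm]; exact hc0 j
  rw [equicorr, covariance_map (measurable_pi_apply i).aestronglyMeasurable
      (measurable_pi_apply j).aestronglyMeasurable (by fun_prop)]
  simp only [Function.comp_def, equicorrMap_apply]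
  have hX' : MemLp (fun ω : ℝ × (ι → ℝ) => √ρ * ω.1) 2 P := hX2.const_mul _
  have hY' : ∀ i, MemLp (fun ω : ℝ × (ι → ℝ) => √(1 - ρ) * ω.2 i) 2 P := fun i =>
    (hY2 i).const_mul _
  have hZ2 : MemLp (fun ω : ℝ × (ι → ℝ) => √ρ * ω.1 + √(1 - ρ) * ω.2 j) 2 P := hX'.add (hY' j)
  erw [covariance_add_left hX' (hY' i) hZ2, covariance_add_right hX' hX' (hY' j),
    covariance_add_right (hY' i) hX' (hY' j)]
  simp only [covariance_const_mul_left, covariance_const_mul_right, hc0, hc0', hcX, hcY]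
  have e1 := mul_self_sqrt h0
  have e2 := mul_self_sqrt (sub_nonneg.2 h1)
  split_ifs <;> linarith

lemma map_eval_equicorr {ρ : ℝ} (h0 : 0 ≤ ρ) (h1 : ρ ≤ 1) (i : ι) :
    (equicorr ι ρ).map (fun x => x i) = gaussianReal 0 1 := by
  have hg : HasGaussianLaw (fun x : ι → ℝ => x) (equicorr ι ρ) :=
    ⟨by rw [show (fun x : ι → ℝ => x) = id from rfl, Measure.map_id]; infer_instance⟩
  rw [(hg.eval i).map_eq_gaussianReal, ← covariance_self (measurable_pi_apply i).aemeasurable,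
    covariance_equicorr h0 h1, if_pos rfl]
  have hmean : ∫ x, x i ∂(equicorr ι ρ) = 0 := by
    set Q := Measure.pi fun _ : ι => gaussianReal 0 1 with hQ
    set P := (gaussianReal 0 1).prod Q with hP
    have hXY : HasGaussianLaw (fun ω : ℝ × (ι → ℝ) => (ω.1, ω.2)) P :=
      ⟨by simpa using (inferInstance : IsGaussian ((gaussianReal 0 1).prod Q))⟩
    have hmap := integral_map (μ := P) (φ := equicorrMap ι (√ρ) (√(1 - ρ))) (by fun_prop)
      (f := fun x : ι → ℝ => x i) (measurable_pi_apply i).aestronglyMeasurable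
    simp only [equicorrMap_apply] at hmap
    refine hmap.trans ?_
    have m1 : ∫ ω, ω.1 ∂P = 0 := by
      rw [integral_fun_fst (f := fun x : ℝ => x), integral_id_gaussianReal]; simp
    have m2 : ∫ ω, ω.2 i ∂P = 0 := by
      rw [integral_fun_snd (f := fun x : ι → ℝ => x i)]
      have := integral_map (μ := Q) (φ := fun x : ι → ℝ => x i)
        (measurable_pi_apply i).aemeasurable (f := fun x => x)
        (measurable_id.aestronglyMeasurable)
      rw [(measurePreserving_eval (fun _ : ι => gaussianReal 0 1) i).map_eq,
        integral_id_gaussianReal] at this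
      rw [← this]; simp
    rw [integral_add (hXY.fst.integrable.const_mul _) ((hXY.snd.eval i).integrable.const_mul _),
      integral_const_mul, integral_const_mul, m1, m2]
    simp
  rw [hmean]
  simp

lemma integral_stepFun_affine (a b u u' : ℝ) {c d z : ℝ} (hd : 0 < d) :
    ∫ t, stepFun a b u u' (c * z + d * t) ∂(gaussianReal 0 1) =
      1 - a * gaussTail ((u - c * z) / d) - b * gaussTail ((u' - c * z) / d) := by
  have h : ∀ v t : ℝ, (Set.Ioi v).indicator (1 : ℝ → ℝ) (c * z + d * t) =
      (Set.Ioi ((v - c * z) / d)).indicator (1 : ℝ → ℝ) t := by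
    intro v t
    have : c * z + d * t ∈ Set.Ioi v ↔ t ∈ Set.Ioi ((v - c * z) / d) := by
      rw [Set.mem_Ioi, Set.mem_Ioi, div_lt_iff₀ hd]
      constructor <;> intro <;> linarith
    simp only [Set.indicator_apply, this, Pi.one_apply]
  have hi : ∀ v : ℝ, Integrable ((Set.Ioi v).indicator (1 : ℝ → ℝ)) (gaussianReal 0 1) := fun v =>
    (integrable_const (1 : ℝ)).indicator measurableSet_Ioi
  simp only [stepFun, h]
  have h1 : Integrable (fun t => 1 - a * (Set.Ioi ((u - c * z) / d)).indicator (1 : ℝ → ℝ) t)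
      (gaussianReal 0 1) := (integrable_const _).sub ((hi _).const_mul _)
  rw [integral_sub h1 ((hi _).const_mul _),
    integral_sub (integrable_const _) ((hi _).const_mul _), integral_const_mul, integral_const_mul,
    integral_indicator_one measurableSet_Ioi, integral_indicator_one measurableSet_Ioi]
  simp [gaussTail]

lemma abs_stepFun_le {a b : ℝ} (ha : 0 ≤ a) (hb : 0 ≤ b) (hab : a + b ≤ 1) (u u' x : ℝ) :
    |stepFun a b u u' x| ≤ 1 := by
  unfold stepFun
  simp only [Set.indicator_apply, Pi.one_apply]
  rw [abs_le]
  split_ifs <;> constructor <;> linarith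

lemma integral_prod_stepFun_equicorr {ρ : ℝ} (h1 : ρ < 1) {a b : ι → ℝ} (ha : ∀ i, 0 ≤ a i)
    (hb : ∀ i, 0 ≤ b i) (hab : ∀ i, a i + b i ≤ 1) (u u' : ℝ) :
    ∫ x, ∏ i, stepFun (a i) (b i) u u' (x i) ∂(equicorr ι ρ) =
      ∫ z, ∏ i, (1 - a i * gaussTail ((u - √ρ * z) / √(1 - ρ)) -
        b i * gaussTail ((u' - √ρ * z) / √(1 - ρ))) ∂(gaussianReal 0 1) := by
  have hm : Measurable fun x : ι → ℝ => ∏ i, stepFun (a i) (b i) u u' (x i) :=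
    Finset.measurable_fun_prod _ fun i _ =>
      (measurable_stepFun _ _ _ _).comp (measurable_pi_apply i)
  rw [equicorr, integral_map (by fun_prop) hm.aestronglyMeasurable, integral_prod]
  · refine integral_congr_ae (ae_of_all _ fun z => ?_)
    simp only [equicorrMap_apply]
    rw [integral_fintype_prod_eq_prod (fun i t => stepFun (a i) (b i) u u' (√ρ * z + √(1 - ρ) * t))]
    exact Finset.prod_congr rfl fun i _ =>
      integral_stepFun_affine _ _ _ _ (sqrt_pos.2 (sub_pos.2 h1))
  · refine Integrable.of_bound (hm.comp (equicorrMap ι _ _).measurable).aestronglyMeasurable 1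
      (ae_of_all _ fun p => ?_)
    rw [norm_eq_abs, Finset.abs_prod]
    exact Finset.prod_le_one (fun i _ => abs_nonneg _)
        fun i _ => abs_stepFun_le (ha i) (hb i) (hab i) _ _ _

end

lemma exists_uniform_bound_lt_one {r : ℕ → ℝ} (h0 : Tendsto r atTop (nhds 0))
    (h1 : ∀ k, 1 ≤ k → |r k| < 1) : ∃ δ, 0 < δ ∧ δ < 1 ∧ ∀ k, 1 ≤ k → |r k| ≤ δ := by
  have hfin : ∀ N : ℕ, ∃ δ, 0 < δ ∧ δ < 1 ∧ ∀ k, 1 ≤ k → k < N → |r k| ≤ δ := by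
    intro N
    induction N with
    | zero => exact ⟨1 / 2, by norm_num, by norm_num, fun k _ hk => absurd hk (by omega)⟩
    | succ N ih =>
      obtain ⟨δ, hδ0, hδ1, hδ⟩ := ih
      rcases Nat.eq_zero_or_pos N with rfl | hN
      · exact ⟨δ, hδ0, hδ1, fun k hk hk' => absurd hk' (by omega)⟩
      · refine ⟨max δ |r N|, lt_max_of_lt_left hδ0, max_lt hδ1 (h1 N hN), fun k hk hk' => ?_⟩
        rcases Nat.lt_succ_iff_lt_or_eq.1 hk' with h | rfl
        · exact (hδ k hk h).trans (le_max_left _ _)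
        · exact le_max_right _ _
  have hev : ∀ᶠ k in atTop, |r k| < 1 / 2 := by
    have := h0.abs
    rw [abs_zero] at this
    exact this.eventually_lt_const (by norm_num)
  obtain ⟨N, hN⟩ := eventually_atTop.1 hev
  obtain ⟨δ, hδ0, hδ1, hδ⟩ := hfin N
  refine ⟨max δ (1 / 2), lt_max_of_lt_left hδ0, max_lt hδ1 (by norm_num), fun k hk => ?_⟩
  rcases lt_or_ge k N with h | h
  · exact (hδ k hk h).trans (le_max_left _ _)
  · exact (hN k h).le.trans (le_max_right _ _)

lemma tendsto_zero_of_tendsto_mul_log {r : ℕ → ℝ} {γ : ℝ}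
    (hr : Tendsto (fun n : ℕ => r n * log n) atTop (nhds γ)) : Tendsto r atTop (nhds 0) := by
  have h := hr.div_atTop tendsto_log_natCast_atTop
  refine h.congr' ?_
  filter_upwards [tendsto_log_natCast_atTop.eventually_gt_atTop 0] with n hn
  exact mul_div_cancel_right₀ _ hn.ne'

section
variable {Ω : Type*} [MeasurableSpace Ω] {P : Measure Ω} {X : ℕ → Ω → ℝ}

lemma memLp_two_of_map_gaussianReal (hstd : ∀ n, P.map (X n) = gaussianReal 0 1) (n : ℕ) :
    MemLp (X n) 2 P := by
  have : HasGaussianLaw (X n) P := ⟨by rw [hstd]; infer_instance⟩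
  exact this.memLp_two

lemma integral_eq_zero_of_map_gaussianReal (hXmeas : ∀ n, Measurable (X n))
    (hstd : ∀ n, P.map (X n) = gaussianReal 0 1) (n : ℕ) : ∫ ω, X n ω ∂P = 0 := by
  have := integral_map (μ := P) (hXmeas n).aemeasurable (f := fun x : ℝ => x)
    measurable_id.aestronglyMeasurable
  rw [hstd, integral_id_gaussianReal] at this
  exact this.symm

lemma integral_mul_eq_of_stationary (hXmeas : ∀ n, Measurable (X n))
    (hstat : ∀ m k : ℕ, P.map (fun ω => fun i : Fin m => X (i.1 + 1 + k) ω) =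
      P.map (fun ω => fun i : Fin m => X (i.1 + 1) ω)) (a n : ℕ) (ha : 1 ≤ a) :
    ∫ ω, X a ω * X (a + n) ω ∂P = ∫ ω, X 1 ω * X (n + 1) ω ∂P := by
  obtain ⟨k, rfl⟩ : ∃ k, a = 1 + k := ⟨a - 1, by omega⟩
  have hf : AEStronglyMeasurable (fun v : Fin (n + 1) → ℝ => v 0 * v (Fin.last n))
      (P.map (fun ω => fun i : Fin (n + 1) => X (i.1 + 1) ω)) := by
    exact ((measurable_pi_apply 0).mul (measurable_pi_apply (Fin.last n))).aestronglyMeasurable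
  have h1 := integral_map (μ := P) (φ := fun ω => fun i : Fin (n + 1) => X (i.1 + 1) ω)
    (measurable_pi_lambda _ fun i => hXmeas _).aemeasurable hf
  rw [← hstat (n + 1) k] at h1 hf
  rw [integral_map (measurable_pi_lambda _ fun i => hXmeas _).aemeasurable hf] at h1
  simp only [Fin.val_zero, Fin.val_last, zero_add] at h1
  rw [← h1]
  congr! 4
  omega

lemma integral_mul_self_of_map_gaussianReal (hXmeas : ∀ n, Measurable (X n))
    (hstd : ∀ n, P.map (X n) = gaussianReal 0 1) (n : ℕ) : ∫ ω, X n ω * X n ω ∂P = 1 := by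
  have hv := variance_map (μ := P) (X := id) (Y := X n) aemeasurable_id (hXmeas n).aemeasurable
  rw [hstd, variance_id_gaussianReal, Function.id_comp,
    variance_of_integral_eq_zero (hXmeas n).aemeasurable
      (integral_eq_zero_of_map_gaussianReal hXmeas hstd n)] at hv
  simpa [sq] using hv.symm

lemma abs_autocorrelation_lt_one (hXmeas : ∀ n, Measurable (X n))
    (hstd : ∀ n, P.map (X n) = gaussianReal 0 1)
    (hstat : ∀ m k : ℕ, P.map (fun ω => fun i : Fin m => X (i.1 + 1 + k) ω) =
      P.map (fun ω => fun i : Fin m => X (i.1 + 1) ω))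
    (h0 : Tendsto (fun n : ℕ => ∫ ω, X 1 ω * X (n + 1) ω ∂P) atTop (nhds 0)) (k : ℕ) (hk : 1 ≤ k) :
    |∫ ω, X 1 ω * X (k + 1) ω ∂P| < 1 := by
  set r := fun n : ℕ => ∫ ω, X 1 ω * X (n + 1) ω ∂P with hrdef
  have hL := memLp_two_of_map_gaussianReal hstd
  have hI : ∀ i j, Integrable (fun ω => X i ω * X j ω) P := fun i j => (hL i).integrable_mul (hL j)
  have hsq := integral_mul_self_of_map_gaussianReal hXmeas hstd
  have hexp : ∀ (s : ℝ) (a : ℕ), 1 ≤ a →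
      ∫ ω, (X (a + k) ω - s * X a ω) ^ 2 ∂P = 1 - 2 * s * r k + s ^ 2 := by
    intro s a ha
    have e : ∀ ω, (X (a + k) ω - s * X a ω) ^ 2 = X (a + k) ω * X (a + k) ω -
        2 * s * (X a ω * X (a + k) ω) + s ^ 2 * (X a ω * X a ω) := fun ω => by ring
    have hi1 : Integrable (fun ω => X (a + k) ω * X (a + k) ω -
        2 * s * (X a ω * X (a + k) ω)) P := (hI _ _).sub ((hI _ _).const_mul _)
    simp only [e]
    rw [integral_add hi1 ((hI _ _).const_mul _), integral_sub (hI _ _) ((hI _ _).const_mul _),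
      integral_const_mul, integral_const_mul, hsq, hsq,
      integral_mul_eq_of_stationary hXmeas hstat a k ha]
    ring
  have hnn : ∀ s, 0 ≤ 1 - 2 * s * r k + s ^ 2 := fun s => by
    rw [← hexp s 1 le_rfl]; exact integral_nonneg fun ω => sq_nonneg _
  by_contra! hcon
  have hr1 : r k ^ 2 = 1 := by
    have h1 := hnn (r k)
    have h2 : 1 ≤ r k ^ 2 := by rw [← sq_abs]; nlinarith [abs_nonneg (r k)]
    nlinarith
  have hae : ∀ a, 1 ≤ a → (fun ω => X (a + k) ω) =ᵐ[P] fun ω => r k * X a ω := by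
    intro a ha
    have h := hexp (r k) a ha
    have hz : 1 - 2 * r k * r k + r k ^ 2 = 0 := by nlinarith
    have hint : Integrable (fun ω => (X (a + k) ω - r k * X a ω) ^ 2) P :=
      ((hL (a + k)).sub ((hL a).const_mul (r k))).integrable_sq
    rw [hz, integral_eq_zero_iff_of_nonneg (fun ω => sq_nonneg _) hint] at h
    filter_upwards [h] with ω hω
    simpa [sub_eq_zero] using hω
  have hstep : ∀ j : ℕ, |r (j * k)| = 1 := by
    intro j
    induction j with
    | zero => simp [hrdef, hsq]
    | succ j ih =>
      have : r ((j + 1) * k) = r k * r (j * k) := by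
        simp only [hrdef]
        rw [← integral_const_mul]
        refine integral_congr_ae ?_
        filter_upwards [hae (j * k + 1) (by omega)] with ω hω
        rw [show (j + 1) * k + 1 = j * k + 1 + k by ring, hω]
        simp only [hrdef]; ring
      have hk1 : |r k| = 1 := by rw [← sqrt_sq_eq_abs, hr1, sqrt_one]
      rw [this, abs_mul, ih, hk1, one_mul]
  have hlim : Tendsto (fun j : ℕ => |r (j * k)|) atTop (nhds |0|) :=
    (h0.comp (tendsto_id.atTop_mul_const' (by omega))).abs
  simp only [hstep, abs_zero] at hlim
  exact zero_ne_one (tendsto_nhds_unique hlim tendsto_const_nhds)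

lemma isGaussian_map_of_forall_sum (hXmeas : ∀ n, Measurable (X n))
    (hGauss : ∀ (m : ℕ) (idx : Fin m → ℕ) (c : Fin m → ℝ), ∃ v : ℝ≥0,
      P.map (fun ω => ∑ i, c i * X (idx i) ω) = gaussianReal 0 v) (n : ℕ) :
    IsGaussian (P.map (fun ω => fun i : Fin n => X (i.1 + 1) ω)) := by
  have hm : Measurable (fun ω => fun i : Fin n => X (i.1 + 1) ω) :=
    measurable_pi_lambda _ fun i => hXmeas _
  refine isGaussian_of_isGaussian_map fun L => ?_
  rw [Measure.map_map (by fun_prop) hm]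
  obtain ⟨v, hv⟩ := hGauss n (fun i => i.1 + 1) (fun i => L (Pi.single i 1))
  have : (L ∘ fun ω => fun i : Fin n => X (i.1 + 1) ω) =
      fun ω => ∑ i, L (Pi.single i 1) * X (i.1 + 1) ω := by
    ext ω
    have h := L.toLinearMap.pi_apply_eq_sum_univ (fun i : Fin n => X (i.1 + 1) ω)
    simp only [Function.comp_apply]
    refine h.trans (Finset.sum_congr rfl fun i _ => ?_)
    rw [smul_eq_mul, mul_comm]
    refine congrArg (· * _) (congrArg L (funext fun j => ?_))
    simp [Pi.single_apply, eq_comm]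
  rw [this, hv]
  infer_instance

variable [IsProbabilityMeasure P]

lemma covariance_map_eq_autocorrelation (hXmeas : ∀ n, Measurable (X n))
    (hstd : ∀ n, P.map (X n) = gaussianReal 0 1)
    (hstat : ∀ m k : ℕ, P.map (fun ω => fun i : Fin m => X (i.1 + 1 + k) ω) =
      P.map (fun ω => fun i : Fin m => X (i.1 + 1) ω)) (n : ℕ) (i j : Fin n) :
    cov[fun x => x i, fun x => x j; P.map (fun ω => fun i : Fin n => X (i.1 + 1) ω)] =
      ∫ ω, X 1 ω * X (Nat.dist i j + 1) ω ∂P := by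
  have hL := memLp_two_of_map_gaussianReal hstd
  rw [covariance_map (measurable_pi_apply i).aestronglyMeasurable
      (measurable_pi_apply j).aestronglyMeasurable
      (measurable_pi_lambda _ fun i => hXmeas _).aemeasurable]
  simp only [Function.comp_def]
  rw [covariance_eq_sub (hL _) (hL _), integral_eq_zero_of_map_gaussianReal hXmeas hstd, zero_mul,
    sub_zero]
  rcases le_total i j with h | h
  · rw [Nat.dist_eq_sub_of_le (Fin.le_def.1 h),
      ← integral_mul_eq_of_stationary hXmeas hstat (i.1 + 1) _ (by omega)]
    have : i.1 + 1 + (j.1 - i.1) = j.1 + 1 := by have := Fin.le_def.1 h; omega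
    rw [this]; rfl
  · rw [Nat.dist_eq_sub_of_le_right (Fin.le_def.1 h),
      ← integral_mul_eq_of_stationary hXmeas hstat (j.1 + 1) _ (by omega)]
    have : j.1 + 1 + (i.1 - j.1) = i.1 + 1 := by have := Fin.le_def.1 h; omega
    rw [this]; simp only [Pi.mul_apply, mul_comm]

end

lemma sum_sum_erase_dist_le {F : ℕ → ℝ} (hF : ∀ k, 0 ≤ F k) (n : ℕ) :
    ∑ i : Fin n, ∑ j ∈ Finset.univ.erase i, F (Nat.dist i j) ≤
      2 * (n * ∑ k ∈ Finset.Icc 1 n, F k) := by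
  have key : ∀ i : Fin n, ∑ j ∈ Finset.univ.erase i, F (Nat.dist i j) ≤
      2 * ∑ k ∈ Finset.Icc 1 n, F k := by
    intro i
    rw [← Finset.sum_filter_add_sum_filter_not (Finset.univ.erase i) (fun j => i < j), two_mul]
    have hsub : ∀ s : Finset (Fin n), i ∉ s →
        Set.InjOn (fun j : Fin n => Nat.dist i j) s →
        ∑ j ∈ s, F (Nat.dist i j) ≤ ∑ k ∈ Finset.Icc 1 n, F k := by
      intro s hs hinj
      rw [← Finset.sum_image (f := F) hinj]
      refine Finset.sum_le_sum_of_subset_of_nonneg ?_ fun k _ _ => hF k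
      intro k hk
      obtain ⟨j, hj, rfl⟩ := Finset.mem_image.1 hk
      have hne : i ≠ j := fun h => hs (h ▸ hj)
      have hne' : i.1 ≠ j.1 := fun h => hne (Fin.ext h)
      rw [Finset.mem_Icc]
      have := i.2; have := j.2
      unfold Nat.dist
      omega
    refine add_le_add (hsub _ (by simp) ?_) (hsub _ (by simp) ?_)
    · intro a ha b hb hab
      simp only [Finset.coe_filter, Finset.mem_erase, Finset.mem_univ, Set.mem_ofPred_eq,
        Fin.lt_def] at ha hb
      simp only [Nat.dist] at hab
      exact Fin.ext (by omega)
    · intro a ha b hb hab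
      simp only [Finset.coe_filter, Finset.mem_erase, Finset.mem_univ, Set.mem_ofPred_eq,
        Fin.lt_def, not_lt] at ha hb
      simp only [Nat.dist] at hab
      exact Fin.ext (by omega)
  calc _ ≤ ∑ _i : Fin n, 2 * ∑ k ∈ Finset.Icc 1 n, F k := Finset.sum_le_sum fun i _ => key i
    _ = _ := by simp; ring

lemma exists_tendsto_zero_abs_integral_sub_le {Ω : Type*} [MeasurableSpace Ω] {P : Measure Ω}
    [IsProbabilityMeasure P] {X : ℕ → Ω → ℝ} {γ : ℝ} (hγ : 0 ≤ γ)
    (hXmeas : ∀ n, Measurable (X n))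
    (hGauss : ∀ (m : ℕ) (idx : Fin m → ℕ) (c : Fin m → ℝ), ∃ v : ℝ≥0,
      P.map (fun ω => ∑ i, c i * X (idx i) ω) = gaussianReal 0 v)
    (hstd : ∀ n, P.map (X n) = gaussianReal 0 1)
    (hstat : ∀ m k : ℕ, P.map (fun ω => fun i : Fin m => X (i.1 + 1 + k) ω) =
      P.map (fun ω => fun i : Fin m => X (i.1 + 1) ω))
    (hr : Tendsto (fun n : ℕ => (∫ ω, X 1 ω * X (n + 1) ω ∂P) * log n) atTop (nhds γ))
    {x y : ℝ} (hxy : x ≤ y) :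
    ∃ err : ℕ → ℝ, Tendsto err atTop (nhds 0) ∧ ∀ᶠ n : ℕ in atTop, ∀ a b : Fin n → ℝ,
      (∀ i, 0 ≤ a i) → (∀ i, 0 ≤ b i) → (∀ i, a i + b i ≤ 1) →
      |∫ ω, ∏ i : Fin n, stepFun (a i) (b i) (un n x) (un n y) (X (i.1 + 1) ω) ∂P -
        ∫ z, ∏ i, (1 - a i * gaussTail (condLevel γ n x z) - b i * gaussTail (condLevel γ n y z))
          ∂(gaussianReal 0 1)| ≤ err n := by
  set r := fun n : ℕ => ∫ ω, X 1 ω * X (n + 1) ω ∂P with hrdef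
  have hr0 : Tendsto r atTop (nhds 0) := tendsto_zero_of_tendsto_mul_log hr
  obtain ⟨δ, hδ0, hδ1, hδ⟩ := exists_uniform_bound_lt_one hr0
    (abs_autocorrelation_lt_one hXmeas hstd hstat hr0)
  obtain ⟨K, hK0, hK⟩ := exists_abs_deriv_smoothTransition_le
  have hlim := (tendsto_berman_sum hγ hδ0 hδ1 hδ hr x).const_mul (2 * (4 * K ^ 2) * (π / 2))
  rw [mul_zero] at hlim
  refine ⟨_, hlim, ?_⟩
  have hρ : Tendsto (fun n : ℕ => γ / log n) atTop (nhds 0) :=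
    tendsto_const_nhds.div_atTop tendsto_log_natCast_atTop
  filter_upwards [hρ.eventually_lt_const one_pos, tendsto_log_natCast_atTop.eventually_gt_atTop 0,
    (tendsto_un_atTop x).eventually_ge_atTop 0] with n hρ1 hlog hun a b ha hb hab
  have hρ0 : 0 ≤ γ / log n := div_nonneg hγ hlog.le
  set ρ := γ / log n
  have hm : Measurable (fun ω => fun i : Fin n => X (i.1 + 1) ω) :=
    measurable_pi_lambda _ fun i => hXmeas _
  have := isGaussian_map_of_forall_sum hXmeas hGauss n
  have hmapX : ∀ i : Fin n, (P.map (fun ω => fun i : Fin n => X (i.1 + 1) ω)).map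
      (fun x => x i) = gaussianReal 0 1 := fun i => by
    rw [Measure.map_map (measurable_pi_apply i) hm]
    exact hstd _
  have hcX := covariance_map_eq_autocorrelation hXmeas hstd hstat n
  have hcE := covariance_equicorr (ι := Fin n) hρ0 hρ1.le
  have hdist : ∀ i j : Fin n, i ≠ j → 1 ≤ Nat.dist i j := fun i j hij =>
    Nat.dist_pos_of_ne fun h => hij (Fin.ext h)
  have hcomp := abs_integral_prod_stepFun_sub_le hmapX (map_eval_equicorr hρ0 hρ1.le) ha hb hab hun
    (un_mono hxy) hK0 hK (w := fun i j => max |r (Nat.dist i j)| ρ)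
    (fun i j hij => max_lt ((hδ _ (hdist i j hij)).trans_lt hδ1) hρ1)
    (fun i j hij => by rw [hcX]; exact le_max_left _ _)
    (fun i j hij => by rw [hcE, if_neg hij, abs_of_nonneg hρ0]; exact le_max_right _ _)
  have hmeas : Measurable fun v : Fin n → ℝ =>
      ∏ i, stepFun (a i) (b i) (un n x) (un n y) (v i) :=
    Finset.measurable_fun_prod _ fun i _ =>
      (measurable_stepFun _ _ _ _).comp (measurable_pi_apply i)
  rw [integral_map hm.aemeasurable hmeas.aestronglyMeasurable,
    integral_prod_stepFun_equicorr hρ1 ha hb hab] at hcomp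
  refine hcomp.trans ?_
  have hsum : ∀ i j : Fin n, j ≠ i →
      |cov[fun x => x i, fun x => x j; P.map (fun ω => fun i : Fin n => X (i.1 + 1) ω)] -
        cov[fun x => x i, fun x => x j; equicorr (Fin n) ρ]| =
      |r (Nat.dist i j) - ρ| := by
    intro i j hj
    rw [hcX, hcE, if_neg hj.symm]
  have hD := sum_sum_erase_dist_le (F := fun k => |r k - ρ| * (4 * K ^ 2 *
    ((√(1 - max |r k| ρ ^ 2))⁻¹ * rexp (-(un n x ^ 2 / (1 + max |r k| ρ))))))
    (fun k => by positivity) n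
  refine (mul_le_mul_of_nonneg_right (hD.trans' (le_of_eq ?_)) (by positivity)).trans
    (le_of_eq ?_)
  · refine Finset.sum_congr rfl fun i _ => Finset.sum_congr (by ext; simp) fun j hj => ?_
    rw [hsum i j (Finset.ne_of_mem_erase hj)]
  have : ∀ k, |r k - ρ| * (4 * K ^ 2 *
    ((√(1 - max |r k| ρ ^ 2))⁻¹ * rexp (-(un n x ^ 2 / (1 + max |r k| ρ))))) =
    4 * K ^ 2 * (|r k - ρ| *
    ((√(1 - max |r k| ρ ^ 2))⁻¹ * rexp (-(un n x ^ 2 / (1 + max |r k| ρ))))) := fun k => by ring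
  simp only [this, ← Finset.mul_sum]
  ring

/-- Weight of the lower level: unobserved variables are marked with `s` above it. -/
noncomputable def coefLow (s : ℝ) (e : Bool) : ℝ := if e then 0 else 1 - s

/-- Weight of the upper level: variables above it are marked with an additional factor `t`. -/
noncomputable def coefHigh (s t : ℝ) (e : Bool) : ℝ := if e then 1 - t else s * (1 - t)

lemma coefLow_nonneg {s : ℝ} (hs : s ≤ 1) (e : Bool) : 0 ≤ coefLow s e := by
  unfold coefLow; split_ifs <;> linarith

lemma coefHigh_nonneg {s t : ℝ} (hs : 0 ≤ s) (ht : t ≤ 1) (e : Bool) : 0 ≤ coefHigh s t e := by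
  have : 0 ≤ s * (1 - t) := mul_nonneg hs (by linarith)
  unfold coefHigh; split_ifs <;> linarith

lemma coefLow_add_coefHigh_le {s t : ℝ} (hs : 0 ≤ s) (ht : 0 ≤ t) (e : Bool) :
    coefLow s e + coefHigh s t e ≤ 1 := by
  have : 0 ≤ s * t := mul_nonneg hs ht
  unfold coefLow coefHigh; split_ifs <;> linarith

lemma stepFun_coef (s t : ℝ) (e : Bool) {u u' : ℝ} (huu : u ≤ u') (v : ℝ) :
    stepFun (coefLow s e) (coefHigh s t e) u u' v =
      (if u < v ∧ e = false then s else 1) * (if u' < v then t else 1) := by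
  unfold stepFun coefLow coefHigh
  simp only [Set.indicator_apply, Set.mem_Ioi, Pi.one_apply]
  rcases lt_or_ge u' v with h | h
  · have h' := huu.trans_lt h
    cases e
    · simp [h, h']
      ring
    · simp [h, h']
  · rcases lt_or_ge u v with h' | h'
    · cases e <;> simp [h.not_gt, h']
    · cases e <;> simp [h.not_gt, h'.not_gt]

lemma prod_fin_succ_eq_prod_Icc {M : Type*} [CommMonoid M] (f : ℕ → M) (n : ℕ) :
    ∏ i : Fin n, f (i.1 + 1) = ∏ k ∈ Finset.Icc 1 n, f k := by
  rw [Fin.prod_univ_eq_prod_range (fun i => f (i + 1)) n]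
  induction n with
  | zero => simp
  | succ n ih => rw [Finset.prod_range_succ, ih, Finset.prod_Icc_succ_top (by omega)]

lemma prod_stepFun_coef (s t : ℝ) (e : ℕ → Bool) {u u' : ℝ} (huu : u ≤ u') (v : ℕ → ℝ) (n : ℕ) :
    ∏ i : Fin n, stepFun (coefLow s (e (i.1 + 1))) (coefHigh s t (e (i.1 + 1))) u u' (v (i.1 + 1)) =
      s ^ ((Finset.Icc 1 n).filter (fun j => u < v j ∧ e j = false)).card *
        t ^ ((Finset.Icc 1 n).filter (fun j => u' < v j)).card := by
  rw [prod_fin_succ_eq_prod_Icc (fun k => stepFun (coefLow s (e k)) (coefHigh s t (e k)) u u'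
    (v k))]
  simp only [stepFun_coef s t _ huu]
  rw [Finset.prod_mul_distrib, Finset.prod_ite, Finset.prod_ite]
  simp

lemma prod_one_sub_coef (s t : ℝ) (e : ℕ → Bool) (a b : ℝ) (n : ℕ) :
    ∏ i : Fin n, (1 - coefLow s (e (i.1 + 1)) * a - coefHigh s t (e (i.1 + 1)) * b) =
      (1 - (1 - t) * b) ^ ((Finset.Icc 1 n).filter (fun k => e k = true)).card *
      (1 - ((1 - s) * a + s * (1 - t) * b)) ^
        ((Finset.Icc 1 n).filter (fun k => ¬ e k = true)).card := by
  rw [prod_fin_succ_eq_prod_Icc (fun k => 1 - coefLow s (e k) * a - coefHigh s t (e k) * b)]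
  have : ∀ k, 1 - coefLow s (e k) * a - coefHigh s t (e k) * b =
      if e k = true then 1 - (1 - t) * b else 1 - ((1 - s) * a + s * (1 - t) * b) := by
    intro k
    unfold coefLow coefHigh
    split_ifs <;> ring
  simp only [this]
  rw [Finset.prod_ite]
  simp

lemma tendsto_one_sub_pow_exp {α : ℕ → ℝ} {N : ℕ → ℕ} {c : ℝ} (hα : Tendsto α atTop (nhds 0))
    (h : Tendsto (fun k => (N k : ℝ) * α k) atTop (nhds c)) :
    Tendsto (fun k => (1 - α k) ^ N k) atTop (nhds (rexp (-c))) := by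
  have hup : Tendsto (fun k => rexp (-((N k : ℝ) * α k))) atTop (nhds (rexp (-c))) :=
    (continuous_exp.tendsto _).comp h.neg
  have hlow : Tendsto (fun k => rexp (-((N k : ℝ) * α k / (1 - α k)))) atTop
      (nhds (rexp (-c))) := by
    have h1 : Tendsto (fun k => 1 - α k) atTop (nhds (1 - 0)) := tendsto_const_nhds.sub hα
    have h2 := h.div h1 (by norm_num)
    rw [sub_zero, div_one] at h2
    exact (continuous_exp.tendsto _).comp h2.neg
  have hev := hα.eventually_lt_const one_pos
  refine tendsto_of_tendsto_of_tendsto_of_le_of_le' hlow hup ?_ ?_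
  · filter_upwards [hev] with k hk
    have hpos : 0 < 1 - α k := by linarith
    have : rexp (-(α k / (1 - α k))) ≤ 1 - α k := by
      have h1 := add_one_le_exp (α k / (1 - α k))
      have h2 : α k / (1 - α k) + 1 = (1 - α k)⁻¹ := by field_simp; ring
      rw [h2] at h1
      rw [exp_neg]
      exact inv_le_of_inv_le₀ hpos h1
    calc _ = rexp (-(α k / (1 - α k))) ^ N k := by rw [← exp_nat_mul]; congr 1; ring
      _ ≤ _ := pow_le_pow_left₀ (exp_pos _).le this _
  · filter_upwards [hev] with k hk
    calc (1 - α k) ^ N k ≤ rexp (-α k) ^ N k :=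
          pow_le_pow_left₀ (by linarith) (by linarith [add_one_le_exp (-α k)]) _
      _ = _ := by rw [← exp_nat_mul]; congr 1; ring

lemma integral_prod_stepFun_indep {Ω : Type*} [MeasurableSpace Ω] {P : Measure Ω}
    [IsProbabilityMeasure P] {X : ℕ → Ω → ℝ} {ε : ℕ → Ω → Bool}
    (hXmeas : ∀ n, Measurable (X n)) (hεmeas : ∀ n, Measurable (ε n))
    (hindep : IndepFun (fun ω => fun n => X n ω) (fun ω => fun n => ε n ω) P)
    {s t : ℝ} (hs0 : 0 ≤ s) (hs1 : s ≤ 1) (ht0 : 0 ≤ t) (ht1 : t ≤ 1) (u u' : ℝ) (n : ℕ) :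
    ∫ ω, ∏ i : Fin n, stepFun (coefLow s (ε (i.1 + 1) ω)) (coefHigh s t (ε (i.1 + 1) ω)) u u'
        (X (i.1 + 1) ω) ∂P =
      ∫ ω', ∫ ω, ∏ i : Fin n, stepFun (coefLow s (ε (i.1 + 1) ω')) (coefHigh s t (ε (i.1 + 1) ω'))
        u u' (X (i.1 + 1) ω) ∂P ∂P := by
  set F : (ℕ → ℝ) × (ℕ → Bool) → ℝ := fun p =>
    ∏ i : Fin n, stepFun (coefLow s (p.2 (i.1 + 1))) (coefHigh s t (p.2 (i.1 + 1))) u u'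
      (p.1 (i.1 + 1)) with hF
  have hind : ∀ v : ℝ, Measurable ((Set.Ioi v).indicator (1 : ℝ → ℝ)) := fun v =>
    measurable_one.indicator measurableSet_Ioi
  have hFm : Measurable F := by
    refine Finset.measurable_fun_prod _ fun i _ => ?_
    have h1 : Measurable fun p : (ℕ → ℝ) × (ℕ → Bool) => coefLow s (p.2 (i.1 + 1)) :=
      (measurable_of_finite (coefLow s)).comp (by fun_prop)
    have h2 : Measurable fun p : (ℕ → ℝ) × (ℕ → Bool) => coefHigh s t (p.2 (i.1 + 1)) :=
      (measurable_of_finite (coefHigh s t)).comp (by fun_prop)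
    have h3 : Measurable fun p : (ℕ → ℝ) × (ℕ → Bool) => p.1 (i.1 + 1) := by fun_prop
    exact (measurable_const.sub (h1.mul ((hind u).comp h3))).sub (h2.mul ((hind u').comp h3))
  have hFb : ∀ p, ‖F p‖ ≤ 1 := fun p => by
    rw [norm_eq_abs, hF, Finset.abs_prod]
    exact Finset.prod_le_one (fun i _ => abs_nonneg _) fun i _ =>
      abs_stepFun_le (coefLow_nonneg hs1 _) (coefHigh_nonneg hs0 ht1 _)
        (coefLow_add_coefHigh_le hs0 ht0 _) _ _ _
  have hX : Measurable fun ω => fun n => X n ω := measurable_pi_lambda _ hXmeas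
  have hε : Measurable fun ω => fun n => ε n ω := measurable_pi_lambda _ hεmeas
  have hlaw := (indepFun_iff_map_prod_eq_prod_map_map hX.aemeasurable hε.aemeasurable).1 hindep
  have h1 := integral_map (μ := P) (hX.prodMk hε).aemeasurable hFm.aestronglyMeasurable
  have : IsProbabilityMeasure (P.map fun ω => fun n => X n ω) :=
    Measure.isProbabilityMeasure_map hX.aemeasurable
  have : IsProbabilityMeasure (P.map fun ω => fun n => ε n ω) :=
    Measure.isProbabilityMeasure_map hε.aemeasurable
  rw [hlaw, integral_prod_symm _
    (Integrable.of_bound hFm.aestronglyMeasurable 1 (ae_of_all _ hFb))] at h1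
  have hinner : ∀ e : ℕ → Bool, ∫ v, F (v, e) ∂(P.map fun ω => fun n => X n ω) =
      ∫ ω, F (fun n => X n ω, e) ∂P := fun e =>
    integral_map hX.aemeasurable (hFm.comp measurable_prodMk_right).aestronglyMeasurable
  rw [integral_map hε.aemeasurable
    hFm.stronglyMeasurable.integral_prod_left.aestronglyMeasurable] at h1
  simp only [hinner] at h1
  exact h1.symm

lemma measurable_gaussTail_condLevel (γ : ℝ) (n : ℕ) (x : ℝ) :
    Measurable fun z => gaussTail (condLevel γ n x z) := by
  have h : Measurable gaussTail := gaussTail_anti.measurable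
  refine h.comp ?_
  unfold condLevel
  fun_prop

lemma tendsto_gaussTail_condLevel {γ : ℝ} (hγ : 0 ≤ γ) (x z : ℝ) :
    Tendsto (fun n : ℕ => gaussTail (condLevel γ n x z)) atTop (nhds 0) := by
  refine ((tendsto_mul_gaussTail_condLevel hγ x z).div_atTop
    tendsto_natCast_atTop_atTop).congr' ?_
  filter_upwards [eventually_gt_atTop 0] with n hn
  exact mul_div_cancel_left₀ _ (by positivity)

/-- The conditional generating function of the numbers of exceedances in the Poisson limit. -/
noncomputable def limitPgf (γ x y s t l z : ℝ) : ℝ :=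
  rexp (-(l * ((1 - t) * g γ y z))) *
    rexp (-((1 - l) * ((1 - s) * g γ x z + s * (1 - t) * g γ y z)))

lemma tendsto_integral_prod_one_sub {Ω : Type*} [MeasurableSpace Ω] {P : Measure Ω}
    [IsProbabilityMeasure P] {ε : ℕ → Ω → Bool} {lam : Ω → ℝ} {γ : ℝ} (hγ : 0 ≤ γ)
    (hεmeas : ∀ n, Measurable (ε n))
    (hS : TendstoInMeasure P
      (fun n ω => (∑ k ∈ Finset.Icc 1 n, (if ε k ω then (1 : ℝ) else 0)) / n) atTop lam)
    {s t : ℝ} (hs0 : 0 ≤ s) (hs1 : s ≤ 1) (ht0 : 0 ≤ t) (ht1 : t ≤ 1) (x y : ℝ) :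
    Tendsto (fun n : ℕ => ∫ ω, ∫ z, ∏ i : Fin n,
        (1 - coefLow s (ε (i.1 + 1) ω) * gaussTail (condLevel γ n x z) -
          coefHigh s t (ε (i.1 + 1) ω) * gaussTail (condLevel γ n y z)) ∂(gaussianReal 0 1) ∂P)
      atTop (nhds (∫ p, limitPgf γ x y s t (lam p.1) p.2 ∂(P.prod (gaussianReal 0 1)))) := by
  set G : ℕ → Ω × ℝ → ℝ := fun n p => ∏ i : Fin n,
    (1 - coefLow s (ε (i.1 + 1) p.1) * gaussTail (condLevel γ n x p.2) -
      coefHigh s t (ε (i.1 + 1) p.1) * gaussTail (condLevel γ n y p.2)) with hG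
  have hGm : ∀ n, Measurable (G n) := by
    intro n
    refine Finset.measurable_fun_prod _ fun i _ => ?_
    have h1 : Measurable fun p : Ω × ℝ => coefLow s (ε (i.1 + 1) p.1) :=
      (measurable_of_finite (coefLow s)).comp ((hεmeas _).comp measurable_fst)
    have h2 : Measurable fun p : Ω × ℝ => coefHigh s t (ε (i.1 + 1) p.1) :=
      (measurable_of_finite (coefHigh s t)).comp ((hεmeas _).comp measurable_fst)
    exact (measurable_const.sub (h1.mul ((measurable_gaussTail_condLevel γ n x).comp
      measurable_snd))).sub (h2.mul ((measurable_gaussTail_condLevel γ n y).comp measurable_snd))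
  have hGb : ∀ n p, ‖G n p‖ ≤ 1 := by
    intro n p
    rw [norm_eq_abs, hG, Finset.abs_prod]
    refine Finset.prod_le_one (fun i _ => abs_nonneg _) fun i _ => ?_
    have a0 := coefLow_nonneg hs1 (ε (i.1 + 1) p.1)
    have b0 := coefHigh_nonneg hs0 ht1 (ε (i.1 + 1) p.1)
    have ab := coefLow_add_coefHigh_le hs0 ht0 (ε (i.1 + 1) p.1)
    have h1 := mul_nonneg a0 (gaussTail_nonneg (condLevel γ n x p.2))
    have h2 := mul_nonneg b0 (gaussTail_nonneg (condLevel γ n y p.2))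
    have h3 := mul_le_of_le_one_right a0 (gaussTail_le_one (condLevel γ n x p.2))
    have h4 := mul_le_of_le_one_right b0 (gaussTail_le_one (condLevel γ n y p.2))
    rw [abs_le]
    constructor <;> linarith
  have hGi : ∀ n, ∫ ω, ∫ z, G n (ω, z) ∂(gaussianReal 0 1) ∂P =
      ∫ p, G n p ∂(P.prod (gaussianReal 0 1)) := fun n =>
    (integral_prod _ (Integrable.of_bound (hGm n).aestronglyMeasurable 1
      (ae_of_all _ (hGb n)))).symm
  refine tendsto_of_subseq_tendsto fun ns hns => ?_
  obtain ⟨ms, hms, hae⟩ := TendstoInMeasure.exists_seq_tendsto_ae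
    (f := fun k ω => (∑ j ∈ Finset.Icc 1 (ns k), (if ε j ω then (1 : ℝ) else 0)) / ns k)
    (fun η hη => (hS η hη).comp hns)
  refine ⟨ms, ?_⟩
  have hN : Tendsto (fun k => ns (ms k)) atTop atTop := hns.comp hms.tendsto_atTop
  change Tendsto (fun k => ∫ ω, ∫ z, G (ns (ms k)) (ω, z) ∂(gaussianReal 0 1) ∂P) _ _
  simp only [hGi]
  refine tendsto_integral_of_dominated_convergence (fun _ => 1)
    (fun k => (hGm _).aestronglyMeasurable) (integrable_const _)
    (fun k => ae_of_all _ (hGb _)) ?_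
  filter_upwards [Measure.quasiMeasurePreserving_fst.ae hae] with p hp
  have hx0 := (tendsto_gaussTail_condLevel hγ x p.2).comp hN
  have hy0 := (tendsto_gaussTail_condLevel hγ y p.2).comp hN
  have hx := (tendsto_mul_gaussTail_condLevel hγ x p.2).comp hN
  have hy := (tendsto_mul_gaussTail_condLevel hγ y p.2).comp hN
  simp only [Function.comp_def] at hx0 hy0 hx hy
  have hprod := fun k => prod_one_sub_coef s t (fun j => ε j p.1)
    (gaussTail (condLevel γ (ns (ms k)) x p.2)) (gaussTail (condLevel γ (ns (ms k)) y p.2))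
    (ns (ms k))
  simp only [hG, hprod]
  have hcard : ∀ n, (∑ j ∈ Finset.Icc 1 n, (if ε j p.1 then (1 : ℝ) else 0)) =
      (((Finset.Icc 1 n).filter (fun k => ε k p.1 = true)).card : ℝ) := fun n => by simp
  simp only [hcard] at hp
  have hp' : Tendsto (fun k => (((Finset.Icc 1 (ns (ms k))).filter
      (fun j => ¬ ε j p.1 = true)).card : ℝ) / (ns (ms k) : ℝ)) atTop (nhds (1 - lam p.1)) := by
    refine (tendsto_const_nhds.sub hp).congr' ?_
    filter_upwards [hN.eventually_gt_atTop 0] with k hk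
    have hk' : (0 : ℝ) < ns (ms k) := by exact_mod_cast hk
    rw [eq_div_iff hk'.ne', sub_mul, one_mul, div_mul_cancel₀ _ hk'.ne', sub_eq_iff_eq_add']
    have := Finset.card_filter_add_card_filter_not (s := Finset.Icc 1 (ns (ms k)))
      (fun j => ε j p.1 = true)
    rw [Nat.card_Icc, Nat.add_sub_cancel] at this
    exact_mod_cast this.symm
  refine Tendsto.mul (tendsto_one_sub_pow_exp ?_ ?_) (tendsto_one_sub_pow_exp ?_ ?_)
  · simpa using hy0.const_mul (1 - t)
  · refine (hp.mul (hy.const_mul (1 - t))).congr' ?_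
    filter_upwards [hN.eventually_gt_atTop 0] with k hk
    have hk' : (0 : ℝ) < ns (ms k) := by exact_mod_cast hk
    field_simp
  · simpa using (hx0.const_mul (1 - s)).add (hy0.const_mul (s * (1 - t)))
  · refine (hp'.mul ((hx.const_mul (1 - s)).add (hy.const_mul (s * (1 - t))))).congr' ?_
    filter_upwards [hN.eventually_gt_atTop 0] with k hk
    have hk' : (0 : ℝ) < ns (ms k) := by exact_mod_cast hk
    field_simp

/-- The number of unobserved variables among the first `n` above the level `u`. -/
noncomputable def missCount {Ω : Type*} (X : ℕ → Ω → ℝ) (ε : ℕ → Ω → Bool) (n : ℕ) (u : ℝ)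
    (ω : Ω) : ℕ := ((Finset.Icc 1 n).filter (fun j => u < X j ω ∧ ε j ω = false)).card

/-- The number of variables among the first `n` above the level `u`. -/
noncomputable def totalCount {Ω : Type*} (X : ℕ → Ω → ℝ) (n : ℕ) (u : ℝ) (ω : Ω) : ℕ :=
  ((Finset.Icc 1 n).filter (fun j => u < X j ω)).card

lemma tendsto_integral_pow_missCount_mul {Ω : Type*} [MeasurableSpace Ω] {P : Measure Ω}
    [IsProbabilityMeasure P] {X : ℕ → Ω → ℝ} {ε : ℕ → Ω → Bool} {lam : Ω → ℝ} {γ : ℝ}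
    (hγ : 0 ≤ γ) (hXmeas : ∀ n, Measurable (X n)) (hεmeas : ∀ n, Measurable (ε n))
    (hGauss : ∀ (m : ℕ) (idx : Fin m → ℕ) (c : Fin m → ℝ), ∃ v : ℝ≥0,
      P.map (fun ω => ∑ i, c i * X (idx i) ω) = gaussianReal 0 v)
    (hstd : ∀ n, P.map (X n) = gaussianReal 0 1)
    (hstat : ∀ m k : ℕ, P.map (fun ω => fun i : Fin m => X (i.1 + 1 + k) ω) =
      P.map (fun ω => fun i : Fin m => X (i.1 + 1) ω))
    (hr : Tendsto (fun n : ℕ => (∫ ω, X 1 ω * X (n + 1) ω ∂P) * log n) atTop (nhds γ))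
    (hindep : IndepFun (fun ω => fun n => X n ω) (fun ω => fun n => ε n ω) P)
    (hS : TendstoInMeasure P
      (fun n ω => (∑ k ∈ Finset.Icc 1 n, (if ε k ω then (1 : ℝ) else 0)) / n) atTop lam)
    {x y : ℝ} (hxy : x ≤ y)
    {s t : ℝ} (hs0 : 0 ≤ s) (hs1 : s ≤ 1) (ht0 : 0 ≤ t) (ht1 : t ≤ 1) :
    Tendsto (fun n : ℕ => ∫ ω, s ^ missCount X ε n (un n x) ω * t ^ totalCount X n (un n y) ω ∂P)
      atTop (nhds (∫ p, limitPgf γ x y s t (lam p.1) p.2 ∂(P.prod (gaussianReal 0 1)))) := by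
  obtain ⟨err, herr, hle⟩ :=
    exists_tendsto_zero_abs_integral_sub_le hγ hXmeas hGauss hstd hstat hr hxy
  have hmix := tendsto_integral_prod_one_sub hγ hεmeas hS hs0 hs1 ht0 ht1 x y
  refine (tendsto_iff_of_dist ?_).1 hmix
  refine squeeze_zero' (Eventually.of_forall fun _ => dist_nonneg) ?_ herr
  filter_upwards [hle] with n hn
  have hE : ∀ ω, s ^ missCount X ε n (un n x) ω * t ^ totalCount X n (un n y) ω =
      ∏ i : Fin n, stepFun (coefLow s (ε (i.1 + 1) ω)) (coefHigh s t (ε (i.1 + 1) ω)) (un n x)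
        (un n y) (X (i.1 + 1) ω) := fun ω =>
    (prod_stepFun_coef s t (fun k => ε k ω) (un_mono hxy) (fun k => X k ω) n).symm
  simp only [hE]
  rw [integral_prod_stepFun_indep hXmeas hεmeas hindep hs0 hs1 ht0 ht1, dist_comm, dist_eq]
  have hint : ∀ h : (Fin n → Bool) → ℝ, Integrable (fun ω => h fun i => ε (i.1 + 1) ω) P :=
    fun h => (Integrable.of_finite (f := h)).comp_measurable
      (measurable_pi_lambda _ fun i => hεmeas _)
  have hA := hint fun e => ∫ ω, ∏ i, stepFun (coefLow s (e i)) (coefHigh s t (e i)) (un n x)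
    (un n y) (X (i.1 + 1) ω) ∂P
  have hB := hint fun e => ∫ z, ∏ i, (1 - coefLow s (e i) * gaussTail (condLevel γ n x z) -
    coefHigh s t (e i) * gaussTail (condLevel γ n y z)) ∂(gaussianReal 0 1)
  rw [← integral_sub hA hB, ← norm_eq_abs]
  refine (norm_integral_le_of_norm_le_const (C := err n) (ae_of_all _ fun ω => ?_)).trans_eq
    (by simp)
  exact hn _ _ (fun _ => coefLow_nonneg hs1 _) (fun _ => coefHigh_nonneg hs0 ht1 _)
    fun _ => coefLow_add_coefHigh_le hs0 ht0 _

/-- The law of three independent Poisson variables. -/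
noncomputable def poissonTriple (a b c : ℝ≥0) : Measure (ℕ × ℕ × ℕ) :=
  (poissonMeasure a).prod ((poissonMeasure b).prod (poissonMeasure c))

instance isProbabilityMeasure_poissonTriple (a b c : ℝ≥0) :
    IsProbabilityMeasure (poissonTriple a b c) := by
  unfold poissonTriple; infer_instance

lemma integral_poissonTriple_mul (a b c : ℝ≥0) (f₁ f₂ f₃ : ℕ → ℝ) :
    ∫ p, f₁ p.1 * (f₂ p.2.1 * f₃ p.2.2) ∂(poissonTriple a b c) =
      (∫ k, f₁ k ∂(poissonMeasure a)) *
        ((∫ k, f₂ k ∂(poissonMeasure b)) * ∫ k, f₃ k ∂(poissonMeasure c)) := by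
  rw [poissonTriple, integral_prod_mul f₁ (fun q : ℕ × ℕ => f₂ q.1 * f₃ q.2),
    integral_prod_mul f₂ f₃]

lemma integral_pow_poissonMeasure (a : ℝ≥0) (s : ℝ) :
    ∫ k, s ^ k ∂(poissonMeasure a) = rexp (a * (s - 1)) := by
  rw [integral_poissonMeasure]
  have h := (NormedSpace.expSeries_div_hasSum_exp ((a : ℝ) * s)).mul_left (rexp (-a))
  rw [← exp_eq_exp_ℝ, ← exp_add] at h
  rw [show (a : ℝ) * (s - 1) = -a + a * s by ring, ← h.tsum_eq]
  refine tsum_congr fun k => ?_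
  rw [smul_eq_mul, mul_pow]
  ring

lemma integral_ite_eq_poissonMeasure (a : ℝ≥0) (j : ℕ) :
    ∫ k, (if k = j then (1 : ℝ) else 0) ∂(poissonMeasure a) =
      (a : ℝ) ^ j / (Nat.factorial j : ℝ) * rexp (-a) := by
  have : (fun k => if k = j then (1 : ℝ) else 0) = ({j} : Set ℕ).indicator 1 := by
    ext k; simp [Set.indicator_apply]
  rw [this, integral_indicator_one (measurableSet_singleton j), poissonMeasure_real_singleton]
  ring

lemma integral_pow_poissonTriple (a b c : ℝ≥0) (s t : ℝ) :
    ∫ p, s ^ (p.2.1 + p.2.2) * t ^ (p.1 + p.2.1) ∂(poissonTriple a b c) =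
      rexp (a * (t - 1)) * (rexp (b * (s * t - 1)) * rexp (c * (s - 1))) := by
  rw [← integral_pow_poissonMeasure, ← integral_pow_poissonMeasure, ← integral_pow_poissonMeasure,
    ← integral_poissonTriple_mul]
  refine integral_congr_ae (ae_of_all _ fun p => ?_)
  simp only [pow_add, mul_pow]
  ring

lemma ite_le_eq_sum (T I D L m : ℕ) (hm : 1 ≤ m) :
    (if I + D ≤ L then (1 : ℝ) else 0) * (if T + I ≤ m - 1 then 1 else 0) =
      ∑ t ∈ Finset.range m, ∑ i ∈ Finset.range (m - t), ∑ j ∈ Finset.Icc i L,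
        (if T = t then (1 : ℝ) else 0) *
          ((if I = i then 1 else 0) * (if D = j - i then 1 else 0)) := by
  have h1 : ∀ i, ∑ j ∈ Finset.Icc i L, (if D = j - i then (1 : ℝ) else 0) =
      if i + D ≤ L then 1 else 0 := by
    intro i
    have : ∀ j ∈ Finset.Icc i L, (if D = j - i then (1 : ℝ) else 0) =
        if i + D = j then 1 else 0 := by
      intro j hj
      have := (Finset.mem_Icc.1 hj).1
      exact if_congr (by omega) rfl rfl
    rw [Finset.sum_congr rfl this, Finset.sum_ite_eq]
    exact if_congr (by rw [Finset.mem_Icc]; omega) rfl rfl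
  simp only [← Finset.mul_sum, h1]
  simp only [ite_mul, one_mul, zero_mul, Finset.sum_ite_eq, Finset.mem_range]
  split_ifs <;> first | rfl | omega

lemma integral_ite_poissonTriple (a b c : ℝ≥0) (L m : ℕ) (hm : 1 ≤ m) :
    ∫ p, (if p.2.1 + p.2.2 ≤ L then (1 : ℝ) else 0) * (if p.1 + p.2.1 ≤ m - 1 then 1 else 0)
        ∂(poissonTriple a b c) =
      ∑ t ∈ Finset.range m, ∑ i ∈ Finset.range (m - t), ∑ j ∈ Finset.Icc i L,
        (a : ℝ) ^ t / (Nat.factorial t : ℝ) * rexp (-a) *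
          ((b : ℝ) ^ i / (Nat.factorial i : ℝ) * rexp (-b) *
            ((c : ℝ) ^ (j - i) / (Nat.factorial (j - i) : ℝ) * rexp (-c))) := by
  have hi : ∀ t i d : ℕ, Integrable (fun p : ℕ × ℕ × ℕ => (if p.1 = t then (1 : ℝ) else 0) *
      ((if p.2.1 = i then 1 else 0) * (if p.2.2 = d then 1 else 0))) (poissonTriple a b c) :=
    fun t i d => Integrable.of_bound (measurable_of_countable _).aestronglyMeasurable 1
      (ae_of_all _ fun p => by split_ifs <;> simp)
  simp only [ite_le_eq_sum _ _ _ L m hm]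
  rw [integral_finsetSum _ fun t _ => integrable_finsetSum _ fun i _ =>
    integrable_finsetSum _ fun j _ => hi _ _ _]
  refine Finset.sum_congr rfl fun t _ => ?_
  rw [integral_finsetSum _ fun i _ => integrable_finsetSum _ fun j _ => hi _ _ _]
  refine Finset.sum_congr rfl fun i _ => ?_
  rw [integral_finsetSum _ fun j _ => hi _ _ _]
  refine Finset.sum_congr rfl fun j _ => ?_
  rw [integral_poissonTriple_mul a b c (fun k => if k = t then 1 else 0)
    (fun k => if k = i then 1 else 0) (fun k => if k = j - i then 1 else 0)]
  simp only [integral_ite_eq_poissonMeasure]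

lemma exists_polynomial_near_ite (L : ℕ) {η : ℝ} (hη : 0 < η) :
    ∃ p : Polynomial ℝ, ∀ N : ℕ, |p.eval ((1 / 2 : ℝ) ^ N) - if N ≤ L then 1 else 0| ≤ η := by
  obtain ⟨p, hp⟩ := exists_polynomial_near_of_continuousOn 0 1
    (fun x => min 1 (max 0 (2 ^ (L + 1) * x - 1))) (by fun_prop) η hη
  refine ⟨p, fun N => ?_⟩
  have h := (hp ((1 / 2 : ℝ) ^ N) ⟨by positivity, pow_le_one₀ (by norm_num) (by norm_num)⟩).le
  suffices hite : (if N ≤ L then (1 : ℝ) else 0) =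
      min 1 (max 0 (2 ^ (L + 1) * (1 / 2) ^ N - 1)) by rwa [hite]
  have e : (2 : ℝ) ^ (L + 1) * (1 / 2) ^ N = 2 ^ (L + 1) / 2 ^ N := by
    rw [one_div, inv_pow, div_eq_mul_inv]
  rw [e]
  split_ifs with hN
  · have : (2 : ℝ) ≤ 2 ^ (L + 1) / 2 ^ N := by
      rw [le_div_iff₀ (by positivity), mul_comm, ← pow_succ]
      exact pow_le_pow_right₀ (by norm_num) (by omega)
    rw [max_eq_right (by linarith), min_eq_left (by linarith)]
  · have : (2 : ℝ) ^ (L + 1) / 2 ^ N ≤ 1 := by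
      rw [div_le_one (by positivity)]
      exact pow_le_pow_right₀ (by norm_num) (by omega)
    rw [max_eq_left (by linarith), min_eq_right (by norm_num)]

lemma abs_mul_sub_mul_le {p q φ ψ η : ℝ} (hη0 : 0 ≤ η) (hη : η ≤ 1) (hp : |p - φ| ≤ η)
    (hq : |q - ψ| ≤ η) (hφ : |φ| ≤ 1) (hψ : |ψ| ≤ 1) : |p * q - φ * ψ| ≤ 3 * η := by
  have h1 : |p| ≤ 2 := by
    calc |p| = |(p - φ) + φ| := by ring_nf
      _ ≤ _ := (abs_add_le _ _).trans (by linarith)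
  calc |p * q - φ * ψ| = |p * (q - ψ) + (p - φ) * ψ| := by ring_nf
    _ ≤ |p| * |q - ψ| + |p - φ| * |ψ| := by rw [← abs_mul, ← abs_mul]; exact abs_add_le _ _
    _ ≤ 2 * η + η * 1 := by gcongr
    _ = 3 * η := by ring

lemma tendsto_of_forall_approx {a : ℕ → ℝ} {L : ℝ}
    (h : ∀ η > 0, ∃ (u : ℕ → ℝ) (L' : ℝ), Tendsto u atTop (nhds L') ∧
      (∀ n, |a n - u n| ≤ η) ∧ |L' - L| ≤ η) : Tendsto a atTop (nhds L) := by
  rw [Metric.tendsto_atTop']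
  intro e he
  obtain ⟨u, L', hu, h1, h2⟩ := h (e / 4) (by linarith)
  obtain ⟨N, hN⟩ := Metric.tendsto_atTop'.1 hu (e / 4) (by linarith)
  refine ⟨N, fun n hn => ?_⟩
  have h3 := hN n hn
  rw [dist_eq] at h3 ⊢
  calc |a n - L| = |(a n - u n) + (u n - L') + (L' - L)| := by ring_nf
    _ ≤ |a n - u n| + |u n - L'| + |L' - L| := abs_add_three _ _ _
    _ < e := by linarith [h1 n]

lemma eval_mul_eval_pow_eq_sum (p q : Polynomial ℝ) (i j : ℕ) :
    p.eval ((1 / 2 : ℝ) ^ i) * q.eval ((1 / 2 : ℝ) ^ j) =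
      ∑ k ∈ Finset.range (p.natDegree + 1), ∑ k' ∈ Finset.range (q.natDegree + 1),
        p.coeff k * q.coeff k' * (((1 / 2 : ℝ) ^ k) ^ i * ((1 / 2 : ℝ) ^ k') ^ j) := by
  rw [Polynomial.eval_eq_sum_range, Polynomial.eval_eq_sum_range, Finset.sum_mul_sum]
  refine Finset.sum_congr rfl fun k _ => Finset.sum_congr rfl fun k' _ => ?_
  rw [← pow_mul, ← pow_mul, ← pow_mul, ← pow_mul, mul_comm i, mul_comm j]
  ring

lemma g_antitone (γ z : ℝ) {x y : ℝ} (hxy : x ≤ y) : g γ y z ≤ g γ x z :=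
  exp_le_exp.2 (by linarith)

lemma g_pos (γ x z : ℝ) : 0 < g γ x z := exp_pos _

/-- The limiting conditional law of the numbers of observed and unobserved exceedances of the upper
level, and of unobserved variables between the two levels. -/
noncomputable def limitLaw (γ x y l z : ℝ) : Measure (ℕ × ℕ × ℕ) :=
  poissonTriple (l * g γ y z).toNNReal ((1 - l) * g γ y z).toNNReal
    ((1 - l) * (g γ x z - g γ y z)).toNNReal

instance (γ x y l z : ℝ) : IsProbabilityMeasure (limitLaw γ x y l z) := by
  unfold limitLaw; infer_instance

/-- The summand of the limiting joint distribution function. -/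
noncomputable def limitTerm (γ x y l z : ℝ) (t i j : ℕ) : ℝ :=
  (l * g γ y z) ^ t / (Nat.factorial t : ℝ) * rexp (-(l * g γ y z)) *
    (((1 - l) * g γ y z) ^ i / (Nat.factorial i : ℝ) *
      (((1 - l) * (g γ x z - g γ y z)) ^ (j - i) / (Nat.factorial (j - i) : ℝ)) *
      rexp (-((1 - l) * g γ x z)))

section
variable {γ x y l z : ℝ}

lemma coe_rates (hxy : x ≤ y) (hl : l ∈ Set.Icc (0 : ℝ) 1) :
    ((l * g γ y z).toNNReal : ℝ) = l * g γ y z ∧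
    (((1 - l) * g γ y z).toNNReal : ℝ) = (1 - l) * g γ y z ∧
    (((1 - l) * (g γ x z - g γ y z)).toNNReal : ℝ) = (1 - l) * (g γ x z - g γ y z) :=
  ⟨coe_toNNReal _ (mul_nonneg hl.1 (g_pos _ _ _).le),
    coe_toNNReal _ (mul_nonneg (by linarith [hl.2]) (g_pos _ _ _).le),
    coe_toNNReal _ (mul_nonneg (by linarith [hl.2]) (by linarith [g_antitone γ z hxy]))⟩

lemma integral_pow_limitLaw (hxy : x ≤ y) (hl : l ∈ Set.Icc (0 : ℝ) 1) (s t : ℝ) :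
    ∫ p, s ^ (p.2.1 + p.2.2) * t ^ (p.1 + p.2.1) ∂(limitLaw γ x y l z) =
      limitPgf γ x y s t l z := by
  obtain ⟨h1, h2, h3⟩ := coe_rates (γ := γ) (z := z) hxy hl
  rw [limitLaw, integral_pow_poissonTriple, h1, h2, h3, limitPgf, ← exp_add, ← exp_add, ← exp_add]
  congr 1
  ring

lemma integral_ite_limitLaw (hxy : x ≤ y) (hl : l ∈ Set.Icc (0 : ℝ) 1) (L m : ℕ) (hm : 1 ≤ m) :
    ∫ p, (if p.2.1 + p.2.2 ≤ L then (1 : ℝ) else 0) * (if p.1 + p.2.1 ≤ m - 1 then 1 else 0)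
        ∂(limitLaw γ x y l z) =
      ∑ t ∈ Finset.range m, ∑ i ∈ Finset.range (m - t), ∑ j ∈ Finset.Icc i L,
        limitTerm γ x y l z t i j := by
  obtain ⟨h1, h2, h3⟩ := coe_rates (γ := γ) (z := z) hxy hl
  rw [limitLaw, integral_ite_poissonTriple _ _ _ _ _ hm, h1, h2, h3]
  refine Finset.sum_congr rfl fun t _ => Finset.sum_congr rfl fun i _ =>
    Finset.sum_congr rfl fun j _ => ?_
  have e : rexp (-((1 - l) * g γ x z)) =
      rexp (-((1 - l) * g γ y z)) * rexp (-((1 - l) * (g γ x z - g γ y z))) := by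
    rw [← exp_add]; congr 1; ring
  rw [limitTerm, e]
  ring

lemma abs_limitTerm_le (hxy : x ≤ y) (hl : l ∈ Set.Icc (0 : ℝ) 1) (t i j : ℕ) :
    |limitTerm γ x y l z t i j| ≤ 1 := by
  have hP : ∀ (a : ℝ) (k : ℕ), 0 ≤ a → 0 ≤ a ^ k / (Nat.factorial k : ℝ) * rexp (-a) ∧
      a ^ k / (Nat.factorial k : ℝ) * rexp (-a) ≤ 1 := by
    intro a k ha
    refine ⟨by positivity, ?_⟩
    rw [exp_neg, ← div_eq_mul_inv, div_le_one (exp_pos _)]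
    exact pow_div_factorial_le_exp a ha k
  have hg := g_pos γ y z
  have hd := g_antitone γ z hxy
  have h0 := hl.1
  have h1 : 0 ≤ 1 - l := by linarith [hl.2]
  obtain ⟨a0, a1⟩ := hP _ t (mul_nonneg h0 hg.le)
  obtain ⟨b0, b1⟩ := hP _ i (mul_nonneg h1 hg.le)
  obtain ⟨c0, c1⟩ := hP _ (j - i) (mul_nonneg h1 (sub_nonneg.2 hd))
  have e : rexp (-((1 - l) * g γ x z)) =
      rexp (-((1 - l) * g γ y z)) * rexp (-((1 - l) * (g γ x z - g γ y z))) := by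
    rw [← exp_add]; congr 1; ring
  have : limitTerm γ x y l z t i j = (l * g γ y z) ^ t / (Nat.factorial t : ℝ) *
      rexp (-(l * g γ y z)) * ((((1 - l) * g γ y z) ^ i / (Nat.factorial i : ℝ) *
        rexp (-((1 - l) * g γ y z))) * (((1 - l) * (g γ x z - g γ y z)) ^ (j - i) /
        (Nat.factorial (j - i) : ℝ) * rexp (-((1 - l) * (g γ x z - g γ y z))))) := by
    rw [limitTerm, e]; ring
  rw [this, abs_of_nonneg (by positivity)]
  exact mul_le_one₀ a1 (by positivity) (mul_le_one₀ b1 c0 c1)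

lemma abs_limitPgf_le {s t : ℝ} (hs0 : 0 ≤ s) (hs1 : s ≤ 1) (ht1 : t ≤ 1)
    (hl : l ∈ Set.Icc (0 : ℝ) 1) : |limitPgf γ x y s t l z| ≤ 1 := by
  have hx := (g_pos γ x z).le
  have hy := (g_pos γ y z).le
  have h1 : 0 ≤ 1 - l := by linarith [hl.2]
  have h2 : 0 ≤ 1 - t := by linarith
  have h3 : 0 ≤ 1 - s := by linarith
  have h0 := hl.1
  have e1 : 0 ≤ l * ((1 - t) * g γ y z) := by positivity
  have e2 : 0 ≤ (1 - l) * ((1 - s) * g γ x z + s * (1 - t) * g γ y z) := by positivity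
  rw [limitPgf, abs_of_nonneg (by positivity)]
  exact mul_le_one₀ (exp_le_one_iff.2 (by linarith)) (exp_pos _).le (exp_le_one_iff.2 (by linarith))

end

section
variable {Ω : Type*} [MeasurableSpace Ω] {P : Measure Ω} {lam : Ω → ℝ}
  {γ x y : ℝ}

lemma measurable_g_snd (γ x : ℝ) : Measurable fun p : Ω × ℝ => g γ x p.2 := by
  unfold g; fun_prop

lemma ae_prod_mem_Icc (hlam01 : ∀ᵐ ω ∂P, lam ω ∈ Set.Icc (0 : ℝ) 1) :
    ∀ᵐ p ∂(P.prod (gaussianReal 0 1)), lam p.1 ∈ Set.Icc (0 : ℝ) 1 :=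
  Measure.quasiMeasurePreserving_fst.ae hlam01

variable [IsProbabilityMeasure P]

lemma integrable_limitTerm (hlam : Measurable lam) (hlam01 : ∀ᵐ ω ∂P, lam ω ∈ Set.Icc (0 : ℝ) 1)
    (hxy : x ≤ y) (t i j : ℕ) :
    Integrable (fun p : Ω × ℝ => limitTerm γ x y (lam p.1) p.2 t i j)
      (P.prod (gaussianReal 0 1)) := by
  refine Integrable.of_bound (Measurable.aestronglyMeasurable ?_) 1
    ((ae_prod_mem_Icc hlam01).mono fun p hp => abs_limitTerm_le hxy hp t i j)
  have h1 := measurable_g_snd (Ω := Ω) γ x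
  have h2 := measurable_g_snd (Ω := Ω) γ y
  have h3 : Measurable fun p : Ω × ℝ => lam p.1 := hlam.comp measurable_fst
  unfold limitTerm
  fun_prop

lemma integrable_limitPgf (hlam : Measurable lam) (hlam01 : ∀ᵐ ω ∂P, lam ω ∈ Set.Icc (0 : ℝ) 1)
    {s t : ℝ} (hs0 : 0 ≤ s) (hs1 : s ≤ 1) (ht1 : t ≤ 1) :
    Integrable (fun p : Ω × ℝ => limitPgf γ x y s t (lam p.1) p.2)
      (P.prod (gaussianReal 0 1)) := by
  refine Integrable.of_bound (Measurable.aestronglyMeasurable ?_) 1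
    ((ae_prod_mem_Icc hlam01).mono fun p hp => abs_limitPgf_le hs0 hs1 ht1 hp)
  have h1 := measurable_g_snd (Ω := Ω) γ x
  have h2 := measurable_g_snd (Ω := Ω) γ y
  have h3 : Measurable fun p : Ω × ℝ => lam p.1 := hlam.comp measurable_fst
  unfold limitPgf
  fun_prop

end

lemma half_pow_mem_Icc (k : ℕ) : 0 ≤ (1 / 2 : ℝ) ^ k ∧ (1 / 2 : ℝ) ^ k ≤ 1 :=
  ⟨by positivity, pow_le_one₀ (by norm_num) (by norm_num)⟩

section
variable {α : Type*} [MeasurableSpace α] (μ : Measure α) [IsProbabilityMeasure μ] {a b : α → ℕ}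

lemma integrable_ite_le_mul (ha : Measurable a) (hb : Measurable b) (L M : ℕ) :
    Integrable (fun ω => (if a ω ≤ L then (1 : ℝ) else 0) * (if b ω ≤ M then 1 else 0)) μ := by
  refine Integrable.of_bound (Measurable.aestronglyMeasurable ?_) 1 (ae_of_all _ fun ω => ?_)
  · exact ((measurable_of_countable fun k => if k ≤ L then (1 : ℝ) else 0).comp ha).mul
      ((measurable_of_countable fun k => if k ≤ M then (1 : ℝ) else 0).comp hb)
  · split_ifs <;> simp

lemma integrable_half_pow_mul (ha : Measurable a) (hb : Measurable b) (c : ℝ) (k k' : ℕ) :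
    Integrable (fun ω => c * (((1 / 2 : ℝ) ^ k) ^ a ω * ((1 / 2 : ℝ) ^ k') ^ b ω)) μ := by
  refine Integrable.const_mul (Integrable.of_bound (Measurable.aestronglyMeasurable ?_) 1
    (ae_of_all _ fun ω => ?_)) _
  · exact (measurable_const.pow ha).mul (measurable_const.pow hb)
  · rw [norm_eq_abs, abs_of_nonneg (by positivity)]
    exact mul_le_one₀ (pow_le_one₀ (half_pow_mem_Icc k).1 (half_pow_mem_Icc k).2) (by positivity)
      (pow_le_one₀ (half_pow_mem_Icc k').1 (half_pow_mem_Icc k').2)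

variable (p q : Polynomial ℝ)

lemma integrable_eval_mul_eval (ha : Measurable a) (hb : Measurable b) :
    Integrable (fun ω => p.eval ((1 / 2 : ℝ) ^ a ω) * q.eval ((1 / 2 : ℝ) ^ b ω)) μ := by
  simp only [eval_mul_eval_pow_eq_sum]
  exact integrable_finsetSum _ fun k _ => integrable_finsetSum _ fun k' _ =>
    integrable_half_pow_mul μ ha hb _ k k'

lemma integral_eval_mul_eval (ha : Measurable a) (hb : Measurable b) :
    ∫ ω, p.eval ((1 / 2 : ℝ) ^ a ω) * q.eval ((1 / 2 : ℝ) ^ b ω) ∂μ =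
      ∑ k ∈ Finset.range (p.natDegree + 1), ∑ k' ∈ Finset.range (q.natDegree + 1),
        p.coeff k * q.coeff k' * ∫ ω, ((1 / 2 : ℝ) ^ k) ^ a ω * ((1 / 2 : ℝ) ^ k') ^ b ω ∂μ := by
  simp only [eval_mul_eval_pow_eq_sum]
  rw [integral_finsetSum _ fun k _ => integrable_finsetSum _ fun k' _ =>
    integrable_half_pow_mul μ ha hb _ k k']
  refine Finset.sum_congr rfl fun k _ => ?_
  rw [integral_finsetSum _ fun k' _ => integrable_half_pow_mul μ ha hb _ k k']
  exact Finset.sum_congr rfl fun k' _ => integral_const_mul _ _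

lemma abs_integral_ite_sub_integral_eval_le (ha : Measurable a) (hb : Measurable b) {L M : ℕ}
    {η : ℝ} (hpq : ∀ i j : ℕ, |(if i ≤ L then (1 : ℝ) else 0) * (if j ≤ M then 1 else 0) -
      p.eval ((1 / 2 : ℝ) ^ i) * q.eval ((1 / 2 : ℝ) ^ j)| ≤ η) :
    |∫ ω, (if a ω ≤ L then (1 : ℝ) else 0) * (if b ω ≤ M then 1 else 0) ∂μ -
      ∫ ω, p.eval ((1 / 2 : ℝ) ^ a ω) * q.eval ((1 / 2 : ℝ) ^ b ω) ∂μ| ≤ η := by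
  rw [← integral_sub (integrable_ite_le_mul μ ha hb L M)
    (integrable_eval_mul_eval μ p q ha hb), ← norm_eq_abs]
  exact (norm_integral_le_of_norm_le_const (ae_of_all _ fun ω => hpq _ _)).trans_eq (by simp)

end

section
variable {Ω : Type*} [MeasurableSpace Ω] {P : Measure Ω} [IsProbabilityMeasure P] {lam : Ω → ℝ}
  {γ x y : ℝ}

lemma tendsto_joint_cdf_of_tendsto_pgf {A B : ℕ → Ω → ℕ} (hA : ∀ n, Measurable (A n))
    (hB : ∀ n, Measurable (B n)) (hlam : Measurable lam)
    (hlam01 : ∀ᵐ ω ∂P, lam ω ∈ Set.Icc (0 : ℝ) 1) (hxy : x ≤ y)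
    (hpgf : ∀ s t : ℝ, 0 ≤ s → s ≤ 1 → 0 ≤ t → t ≤ 1 →
      Tendsto (fun n => ∫ ω, s ^ A n ω * t ^ B n ω ∂P) atTop
        (nhds (∫ p, limitPgf γ x y s t (lam p.1) p.2 ∂(P.prod (gaussianReal 0 1)))))
    (L m : ℕ) (hm : 1 ≤ m) :
    Tendsto (fun n => P.real {ω | A n ω ≤ L ∧ B n ω ≤ m - 1}) atTop
      (nhds (∫ p, ∑ t ∈ Finset.range m, ∑ i ∈ Finset.range (m - t), ∑ j ∈ Finset.Icc i L,
        limitTerm γ x y (lam p.1) p.2 t i j ∂(P.prod (gaussianReal 0 1)))) := by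
  refine tendsto_of_forall_approx fun η hη => ?_
  set δ := min 1 (η / 3) with hδ
  have hδ0 : 0 < δ := lt_min one_pos (by linarith)
  have hδη : 3 * δ ≤ η := by linarith [min_le_right 1 (η / 3)]
  obtain ⟨p, hp⟩ := exists_polynomial_near_ite L hδ0
  obtain ⟨q, hq⟩ := exists_polynomial_near_ite (m - 1) hδ0
  have hpq : ∀ i j : ℕ, |(if i ≤ L then (1 : ℝ) else 0) * (if j ≤ m - 1 then 1 else 0) -
      p.eval ((1 / 2 : ℝ) ^ i) * q.eval ((1 / 2 : ℝ) ^ j)| ≤ η := by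
    intro i j
    rw [abs_sub_comm]
    exact (abs_mul_sub_mul_le hδ0.le (min_le_left _ _) (hp i) (hq j)
      (by split_ifs <;> simp) (by split_ifs <;> simp)).trans hδη
  have hhalf := half_pow_mem_Icc
  refine ⟨fun n => ∫ ω, p.eval ((1 / 2 : ℝ) ^ A n ω) * q.eval ((1 / 2 : ℝ) ^ B n ω) ∂P,
    ∑ k ∈ Finset.range (p.natDegree + 1), ∑ k' ∈ Finset.range (q.natDegree + 1),
        p.coeff k * q.coeff k' * ∫ ω, limitPgf γ x y ((1 / 2 : ℝ) ^ k) ((1 / 2 : ℝ) ^ k')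
          (lam ω.1) ω.2 ∂(P.prod (gaussianReal 0 1)), ?_, fun n => ?_, ?_⟩
  · simp only [integral_eval_mul_eval P p q (hA _) (hB _)]
    exact tendsto_finsetSum _ fun k _ => tendsto_finsetSum _ fun k' _ =>
      (hpgf _ _ (hhalf k).1 (hhalf k).2 (hhalf k').1 (hhalf k').2).const_mul _
  · have : P.real {ω | A n ω ≤ L ∧ B n ω ≤ m - 1} =
        ∫ ω, (if A n ω ≤ L then (1 : ℝ) else 0) * (if B n ω ≤ m - 1 then 1 else 0) ∂P := by
      have hms : MeasurableSet {ω | A n ω ≤ L ∧ B n ω ≤ m - 1} :=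
        (measurableSet_le (hA n) measurable_const).inter
          (measurableSet_le (hB n) measurable_const)
      rw [← integral_indicator_one hms]
      refine integral_congr_ae (ae_of_all _ fun ω => ?_)
      simp only [Set.indicator_apply, Set.mem_ofPred_eq, Pi.one_apply, ite_and,
        ite_mul, one_mul, zero_mul]
    rw [this]
    exact abs_integral_ite_sub_integral_eval_le P p q (hA n) (hB n) hpq
  · set Q := P.prod (gaussianReal 0 1)
    have hI : ∀ k k' : ℕ, Integrable (fun ω : Ω × ℝ => p.coeff k * q.coeff k' *
        limitPgf γ x y ((1 / 2 : ℝ) ^ k) ((1 / 2 : ℝ) ^ k') (lam ω.1) ω.2) Q := fun k k' =>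
      (integrable_limitPgf hlam hlam01 (hhalf k).1 (hhalf k).2 (hhalf k').2).const_mul _
    have hsum : ∑ k ∈ Finset.range (p.natDegree + 1), ∑ k' ∈ Finset.range (q.natDegree + 1),
        p.coeff k * q.coeff k' * ∫ ω, limitPgf γ x y ((1 / 2 : ℝ) ^ k) ((1 / 2 : ℝ) ^ k')
          (lam ω.1) ω.2 ∂Q =
        ∫ ω, ∑ k ∈ Finset.range (p.natDegree + 1), ∑ k' ∈ Finset.range (q.natDegree + 1),
        p.coeff k * q.coeff k' * limitPgf γ x y ((1 / 2 : ℝ) ^ k) ((1 / 2 : ℝ) ^ k')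
          (lam ω.1) ω.2 ∂Q := by
      rw [integral_finsetSum _ fun k _ => integrable_finsetSum _ fun k' _ => hI k k']
      refine Finset.sum_congr rfl fun k _ => ?_
      rw [integral_finsetSum _ fun k' _ => hI k k']
      exact Finset.sum_congr rfl fun k' _ => (integral_const_mul _ _).symm
    rw [hsum, ← integral_sub (integrable_finsetSum _ fun k _ => integrable_finsetSum _
      fun k' _ => hI k k') (integrable_finsetSum _ fun t _ => integrable_finsetSum _ fun i _ =>
      integrable_finsetSum _ fun j _ => integrable_limitTerm hlam hlam01 hxy t i j), ← norm_eq_abs]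
    refine (norm_integral_le_of_norm_le_const (C := η)
      ((ae_prod_mem_Icc hlam01).mono fun ω hω => ?_)).trans_eq (by simp)
    have hc := abs_integral_ite_sub_integral_eval_le (limitLaw γ x y (lam ω.1) ω.2)
      (a := fun p => p.2.1 + p.2.2) (b := fun p => p.1 + p.2.1) p q
      (measurable_of_countable _) (measurable_of_countable _) hpq
    rw [integral_eval_mul_eval _ p q (measurable_of_countable _) (measurable_of_countable _),
      integral_ite_limitLaw hxy hω L m hm] at hc
    simp only [integral_pow_limitLaw hxy hω] at hc
    rw [norm_eq_abs, abs_sub_comm]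
    exact hc

end

lemma measurable_missCount {Ω : Type*} [MeasurableSpace Ω] {X : ℕ → Ω → ℝ} {ε : ℕ → Ω → Bool}
    (hX : ∀ n, Measurable (X n)) (hε : ∀ n, Measurable (ε n)) (n : ℕ) (u : ℝ) :
    Measurable (missCount X ε n u) := by
  unfold missCount
  simp only [Finset.card_filter]
  exact Finset.measurable_fun_sum _ fun j _ => Measurable.ite
    ((measurableSet_lt measurable_const (hX j)).inter (hε j (measurableSet_singleton false)))
    measurable_const measurable_const

lemma measurable_totalCount {Ω : Type*} [MeasurableSpace Ω] {X : ℕ → Ω → ℝ}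
    (hX : ∀ n, Measurable (X n)) (n : ℕ) (u : ℝ) : Measurable (totalCount X n u) := by
  unfold totalCount
  simp only [Finset.card_filter]
  exact Finset.measurable_fun_sum _ fun j _ => Measurable.ite
    (measurableSet_lt measurable_const (hX j)) measurable_const measurable_const

theorem stmt3
    {Ω : Type} [MeasurableSpace Ω] (P : Measure Ω) [IsProbabilityMeasure P]
    (X : ℕ → Ω → ℝ) (ε : ℕ → Ω → Bool) (lam : Ω → ℝ) (γ : ℝ)
    (hγ : 0 ≤ γ)
    (hXmeas : ∀ n, Measurable (X n))
    (hεmeas : ∀ n, Measurable (ε n))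
    (hlam : Measurable lam)
    -- every finite-dimensional distribution of `X` is centered Gaussian
    (hGauss : ∀ (m : ℕ) (idx : Fin m → ℕ) (c : Fin m → ℝ), ∃ v : ℝ≥0,
      Measure.map (fun ω => ∑ i, c i * X (idx i) ω) P = gaussianReal 0 v)
    -- each `X n` is standard Gaussian
    (hstd : ∀ n, Measure.map (X n) P = gaussianReal 0 1)
    -- stationarity
    (hstat : ∀ (m k : ℕ),
      Measure.map (fun ω => fun i : Fin m => X (i.1 + 1 + k) ω) P =
        Measure.map (fun ω => fun i : Fin m => X (i.1 + 1) ω) P)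
    -- `r_n ln n → γ`
    (hr : Tendsto (fun n : ℕ => (∫ ω, X 1 ω * X (n + 1) ω ∂P) * Real.log n)
      atTop (nhds γ))
    -- independence of the sequences `X` and `ε`
    (hindep : IndepFun (fun ω => fun n => X n ω) (fun ω => fun n => ε n ω) P)
    (hlam01 : ∀ᵐ ω ∂P, lam ω ∈ Set.Icc (0 : ℝ) 1)
    -- `S_n / n → λ` in probability
    (hS : TendstoInMeasure P
      (fun n ω => (∑ k ∈ Finset.Icc 1 n, (if ε k ω then (1 : ℝ) else 0)) / n)
      atTop lam)
    (l m : ℕ) (hl : 1 ≤ l) (hm : 1 ≤ m) (x y : ℝ) (hxy : x < y) :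
    Tendsto (fun n : ℕ =>
      (P {ω | ((Finset.Icc 1 n).filter
            (fun j => un n x < X j ω ∧ ε j ω = false)).card ≤ l - 1 ∧
          ((Finset.Icc 1 n).filter (fun j => un n y < X j ω)).card ≤ m - 1}).toReal)
      atTop
      (nhds (∑ t ∈ Finset.range m, ∑ i ∈ Finset.range (m - t), ∑ j ∈ Finset.Icc i (l - 1),
        ∫ ω, ∫ z,
          (lam ω * g γ y z) ^ t / (Nat.factorial t : ℝ) *
            Real.exp (-(lam ω * g γ y z)) *
          (((1 - lam ω) * g γ y z) ^ i / (Nat.factorial i : ℝ) *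
            (((1 - lam ω) * (g γ x z - g γ y z)) ^ (j - i) / (Nat.factorial (j - i) : ℝ)) *
            Real.exp (-((1 - lam ω) * g γ x z)))
          ∂(gaussianReal 0 1) ∂P)) := by
  have hlim := tendsto_joint_cdf_of_tendsto_pgf
    (fun n => measurable_missCount hXmeas hεmeas n (un n x))
    (fun n => measurable_totalCount hXmeas n (un n y)) hlam hlam01 hxy.le
    (fun s t hs0 hs1 ht0 ht1 => tendsto_integral_pow_missCount_mul hγ hXmeas hεmeas hGauss hstd
      hstat hr hindep hS hxy.le hs0 hs1 ht0 ht1) (l - 1) m hm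
  have hint := integrable_limitTerm (γ := γ) hlam hlam01 hxy.le
  rw [integral_finsetSum _ fun t _ => integrable_finsetSum _ fun i _ =>
    integrable_finsetSum _ fun j _ => hint t i j] at hlim
  refine (congrArg (fun c => Tendsto _ atTop (nhds c)) (Finset.sum_congr rfl fun t _ => ?_)).mp hlim
  rw [integral_finsetSum _ fun i _ => integrable_finsetSum _ fun j _ => hint t i j]
  refine Finset.sum_congr rfl fun i _ => ?_
  rw [integral_finsetSum _ fun j _ => hint t i j]
  refine Finset.sum_congr rfl fun j _ => ?_
  rw [integral_prod _ (hint t i j)]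
  rfl
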